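/- arXiv:1412.1797 — 5 statements merged into one kernel-verified Lean document; each statement's English description precedes it below -/
import Mathlib

section
/- Let x, y : [0,1] → ℝ be Lipschitz functions with x(0)=x(1) and y(0)=y(1). Then the length-squared term dominates the area: ∫₀¹ (ẋ(s)² + ẏ(s)²) ds ≥ 4π · |½ ∫₀¹ (ẏ(s)x(s) − ẋ(s)y(s)) ds|. -/
open Real MeasureTheory

/-- Squared norm of a Fourier coefficient of a real function through its cosine and sine parts. -/
lemma coeff_normSq (g : ℝ → ℝ) (hg : IntervalIntegrable g volume 0 1) (n : ℤ) :
    ‖fourierCoeffOn (zero_lt_one' ℝ) (fun s => (g s : ℂ)) n‖ ^ 2 =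
      (∫ s in (0:ℝ)..1, Real.cos (2 * π * n * s) * g s) ^ 2 +
      (∫ s in (0:ℝ)..1, Real.sin (2 * π * n * s) * g s) ^ 2 := by
  have hc : IntervalIntegrable (fun s => Real.cos (2 * π * n * s) * g s) volume 0 1 :=
    hg.continuousOn_mul (by fun_prop)
  have hs : IntervalIntegrable (fun s => Real.sin (2 * π * n * s) * g s) volume 0 1 :=
    hg.continuousOn_mul (by fun_prop)
  have key : fourierCoeffOn (zero_lt_one' ℝ) (fun s => (g s : ℂ)) n =
      ((∫ s in (0:ℝ)..1, Real.cos (2 * π * n * s) * g s : ℝ) : ℂ) +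
      ((-∫ s in (0:ℝ)..1, Real.sin (2 * π * n * s) * g s : ℝ) : ℂ) * Complex.I := by
    rw [fourierCoeffOn_eq_integral]
    rw [Complex.ofReal_neg, ← intervalIntegral.integral_ofReal, ← intervalIntegral.integral_ofReal,
      ← intervalIntegral.integral_neg, ← intervalIntegral.integral_mul_const,
      ← intervalIntegral.integral_add]
    · simp only [sub_zero, div_one, one_smul]
      apply intervalIntegral.integral_congr
      intro s _
      simp only [fourier_coe_apply, smul_eq_mul]
      have : (2 * π * Complex.I * ((-n : ℤ) : ℂ) * s / ((1 - 0 : ℝ) : ℂ) : ℂ) =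
          ((-(2 * π * n * s) : ℝ) : ℂ) * Complex.I := by
        push_cast; ring
      rw [this, Complex.exp_mul_I, ← Complex.ofReal_cos, ← Complex.ofReal_sin, Real.cos_neg,
        Real.sin_neg]
      push_cast
      ring
    · exact ⟨hc.1.ofReal, hc.2.ofReal⟩
    · have hs' : IntervalIntegrable (fun s => ((Real.sin (2 * π * n * s) * g s : ℝ) : ℂ))
          volume 0 1 := ⟨hs.1.ofReal, hs.2.ofReal⟩
      exact hs'.neg.mul_const _
  rw [key, ← Complex.normSq_eq_norm_sq, Complex.normSq_add_mul_I]
  ring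

lemma deriv_bound {x : ℝ → ℝ} {K : NNReal} (hx : LipschitzOnWith K x (Set.Icc 0 1)) :
    ∀ᵐ s ∂(volume.restrict (Set.Ioc (0:ℝ) 1)), ‖deriv x s‖ ≤ K := by
  rw [← Measure.restrict_congr_set (Ioo_ae_eq_Ioc (a := (0:ℝ)) (b := 1))]
  filter_upwards [ae_restrict_mem measurableSet_Ioo] with s hs
  exact norm_deriv_le_of_lipschitzOn (Icc_mem_nhds hs.1 hs.2) hx

lemma deriv_memLp {x : ℝ → ℝ} {K : NNReal} (hx : LipschitzOnWith K x (Set.Icc 0 1)) :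
    MemLp (deriv x) 2 (volume.restrict (Set.Ioc (0:ℝ) 1)) :=
  MemLp.of_bound (measurable_deriv x).aestronglyMeasurable K (deriv_bound hx)

lemma ac01 {x : ℝ → ℝ} {K : NNReal} (hx : LipschitzOnWith K x (Set.Icc 0 1)) :
    AbsolutelyContinuousOnInterval x 0 1 :=
  LipschitzOnWith.absolutelyContinuousOnInterval (K := K) (by rwa [Set.uIcc_of_le zero_le_one])

lemma cont_memLp {u : ℝ → ℝ} (hu : ContinuousOn u (Set.Icc 0 1)) :
    MemLp u 2 (volume.restrict (Set.Ioc (0:ℝ) 1)) := by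
  obtain ⟨C, hC⟩ := isCompact_Icc.exists_bound_of_continuousOn hu
  refine MemLp.of_bound
    ((hu.mono Set.Ioc_subset_Icc_self).aestronglyMeasurable measurableSet_Ioc) C ?_
  filter_upwards [ae_restrict_mem measurableSet_Ioc] with s hs
  exact hC s (Set.Ioc_subset_Icc_self hs)

lemma wirtinger {u : ℝ → ℝ} {K : NNReal} (hu : LipschitzOnWith K u (Set.Icc 0 1))
    (h01 : u 0 = u 1) (hm : ∫ s in (0:ℝ)..1, u s = 0) :
    4 * π ^ 2 * ∫ s in (0:ℝ)..1, (u s) ^ 2 ≤ ∫ s in (0:ℝ)..1, (deriv u s) ^ 2 := by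
  have hac := ac01 hu
  have hui : IntervalIntegrable u volume 0 1 := hac.continuousOn.intervalIntegrable
  have hdi : IntervalIntegrable (deriv u) volume 0 1 := hac.intervalIntegrable_deriv
  have P1 := hasSum_sq_fourierCoeffOn (zero_lt_one' ℝ) (cont_memLp hu.continuousOn).ofReal
  have P2 := hasSum_sq_fourierCoeffOn (zero_lt_one' ℝ) (deriv_memLp hu).ofReal
  simp only [RCLike.ofReal_eq_complex_ofReal, coeff_normSq u hui, coeff_normSq _ hdi, sub_zero, inv_one, one_smul,
    Complex.norm_real, Real.norm_eq_abs, sq_abs] at P1 P2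
  refine hasSum_le (fun n => ?_) (P1.mul_left (4 * π ^ 2)) P2
  have hcd : ∀ s, HasDerivAt (fun s : ℝ => Real.cos (2 * π * n * s))
      (-(2 * π * n) * Real.sin (2 * π * n * s)) s := fun s => by
    have := ((hasDerivAt_id s).const_mul (2 * π * n)).cos
    simp only [id, mul_one] at this
    convert this using 1; ring
  have hsd : ∀ s, HasDerivAt (fun s : ℝ => Real.sin (2 * π * n * s))
      ((2 * π * n) * Real.cos (2 * π * n * s)) s := fun s => by
    have := ((hasDerivAt_id s).const_mul (2 * π * n)).sin
    simp only [id, mul_one] at this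
    convert this using 1; ring
  have hcac : AbsolutelyContinuousOnInterval (fun s : ℝ => Real.cos (2 * π * n * s)) 0 1 :=
    ContDiffOn.absolutelyContinuousOnInterval (by fun_prop)
  have hsac : AbsolutelyContinuousOnInterval (fun s : ℝ => Real.sin (2 * π * n * s)) 0 1 :=
    ContDiffOn.absolutelyContinuousOnInterval (by fun_prop)
  have e1 := hcac.integral_mul_deriv_eq_deriv_mul hac
  have e2 := hsac.integral_mul_deriv_eq_deriv_mul hac
  have c1 : Real.cos (2 * π * n * 1) = 1 := by
    rw [mul_one, mul_comm]; exact Real.cos_int_mul_two_pi n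
  have s1 : Real.sin (2 * π * n * 1) = 0 := by
    have := Real.sin_int_mul_pi (2 * n)
    rw [← this]; congr 1; push_cast; ring
  simp only [(hcd _).deriv, (hsd _).deriv, c1, s1, mul_zero, Real.cos_zero, Real.sin_zero, h01,
    mul_assoc (-(2 * π * n)), mul_assoc (2 * π * n), intervalIntegral.integral_const_mul] at e1 e2
  rw [e1, e2]
  rcases eq_or_ne n 0 with rfl | hn
  · simp [hm]
  · have : (1:ℝ) ≤ (n:ℝ) ^ 2 := by
      have : (1:ℤ) ≤ n ^ 2 := by
        have : 0 < n ^ 2 := by positivity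
        omega
      exact_mod_cast this
    set C := ∫ s in (0:ℝ)..1, Real.cos (2 * π * n * s) * u s
    set S := ∫ s in (0:ℝ)..1, Real.sin (2 * π * n * s) * u s
    have h0 : 0 ≤ 4 * π ^ 2 * (C ^ 2 + S ^ 2) := by positivity
    nlinarith [mul_le_mul_of_nonneg_right this h0]

/-- Isoperimetric-type inequality for a closed Lipschitz planar curve:
the integral of the squared speed dominates `4π` times the absolute value
of the signed enclosed area. -/
theorem length_sq_ge_four_pi_area
    (x y : ℝ → ℝ) (Kx Ky : NNReal)
    (hx : LipschitzOnWith Kx x (Set.Icc 0 1))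
    (hy : LipschitzOnWith Ky y (Set.Icc 0 1))
    (hx01 : x 0 = x 1) (hy01 : y 0 = y 1) :
    (∫ s in (0:ℝ)..1, ((deriv x s) ^ 2 + (deriv y s) ^ 2)) ≥
      4 * π * |(1 / 2) * ∫ s in (0:ℝ)..1, (deriv y s * x s - deriv x s * y s)| := by
  set m := ∫ s in (0:ℝ)..1, x s with hm
  have hxac := ac01 hx
  have hyac := ac01 hy
  have hxi : IntervalIntegrable x volume 0 1 := hxac.continuousOn.intervalIntegrable
  have hxd := hxac.intervalIntegrable_deriv
  have hyd := hyac.intervalIntegrable_deriv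
  have sqi : ∀ {f : ℝ → ℝ}, MemLp f 2 (volume.restrict (Set.Ioc (0:ℝ) 1)) →
      IntervalIntegrable (fun s => f s ^ 2) volume 0 1 := fun hf =>
    (intervalIntegrable_iff_integrableOn_Ioc_of_le zero_le_one).2 hf.integrable_sq
  have hxd2 := sqi (deriv_memLp hx)
  have hyd2 := sqi (deriv_memLp hy)
  have hu : LipschitzOnWith Kx (fun s => x s - m) (Set.Icc 0 1) := by
    intro a ha b hb
    simpa using hx ha hb
  have hu2 := sqi (cont_memLp hu.continuousOn)
  have hyu : IntervalIntegrable (fun s => deriv y s * (x s - m)) volume 0 1 :=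
    hyd.mul_continuousOn (ac01 hu).continuousOn
  have W := wirtinger hu (by simp [hx01]) (by
    rw [intervalIntegral.integral_sub hxi (by simp)]; simp [← hm])
  simp only [deriv_sub_const] at W
  have hyx : IntervalIntegrable (fun s => deriv y s * x s) volume 0 1 :=
    hyd.mul_continuousOn hxac.continuousOn
  have hxy : IntervalIntegrable (fun s => deriv x s * y s) volume 0 1 :=
    hxd.mul_continuousOn hyac.continuousOn
  have e1 : ∫ s in (0:ℝ)..1, (deriv y s * x s - deriv x s * y s) =
      2 * ∫ s in (0:ℝ)..1, deriv y s * (x s - m) := by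
    have p := hyac.integral_mul_deriv_eq_deriv_mul hxac
    have q := hyac.integral_deriv_eq_sub
    simp only [mul_sub]
    rw [intervalIntegral.integral_sub hyx hxy,
      intervalIntegral.integral_sub hyx (hyd.mul_const m), intervalIntegral.integral_mul_const, q]
    simp only [mul_comm (y _)] at p
    rw [p, hx01, hy01]; ring
  rw [e1, intervalIntegral.integral_add hxd2 hyd2]
  have b : ∀ c : ℝ, c ^ 2 = 4 * π ^ 2 → 2 * c * (∫ s in (0:ℝ)..1, deriv y s * (x s - m)) ≤
      (∫ s in (0:ℝ)..1, (deriv y s) ^ 2) + 4 * π ^ 2 * ∫ s in (0:ℝ)..1, (x s - m) ^ 2 := by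
    intro c hc
    rw [← intervalIntegral.integral_const_mul, ← intervalIntegral.integral_const_mul,
      ← intervalIntegral.integral_add hyd2 (hu2.const_mul _)]
    refine intervalIntegral.integral_mono_on zero_le_one (hyu.const_mul _)
      (hyd2.add (hu2.const_mul _)) fun s _ => ?_
    rw [← hc]
    nlinarith [sq_nonneg (deriv y s - c * (x s - m))]
  have b1 := b (2 * π) (by ring)
  have b2 := b (-(2 * π)) (by ring)
  rw [show ∀ t : ℝ, (1 / 2) * (2 * t) = t from fun t => by ring]
  rcases abs_cases (∫ s in (0:ℝ)..1, deriv y s * (x s - m)) with h | h <;> rw [h.1] <;> nlinarith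
end

section
/- Let γ = (x₁,…,xₙ,y₁,…,yₙ) : [0,1] → ℝ^{2n} be a closed rectifiable curve parametrized with constant speed L (so Σⱼ(ẋⱼ(s)² + ẏⱼ(s)²) = L² a.e.). Then L² ≥ 4π|𝔇| where 𝔇 = Σⱼ ½∫₀¹(ẏⱼ(s)xⱼ(s) − ẋⱼ(s)yⱼ(s)) ds is the sum of the signed areas enclosed by the planar projections γⱼ = (xⱼ, yⱼ). -/
open Real MeasureTheory

lemma iso_memLp_deriv {f : ℝ → ℝ} {K : NNReal} (hf : LipschitzOnWith K f (Set.Icc 0 1)) :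
    MemLp (deriv f) 2 (volume.restrict (Set.Ioc (0:ℝ) 1)) := by
  refine MemLp.of_bound (measurable_deriv f).aestronglyMeasurable K ?_
  rw [← restrict_Ioo_eq_restrict_Ioc, ae_restrict_iff' measurableSet_Ioo]
  filter_upwards with s hs
  exact norm_deriv_le_of_lipschitzOn (Icc_mem_nhds hs.1 hs.2) hf

lemma iso_memLp {f : ℝ → ℝ} {K : NNReal} (hf : LipschitzOnWith K f (Set.Icc 0 1)) :
    MemLp f 2 (volume.restrict (Set.Ioc (0:ℝ) 1)) := by
  obtain ⟨C, hC⟩ := isCompact_Icc.exists_bound_of_continuousOn hf.continuousOn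
  refine MemLp.of_bound
    ((hf.continuousOn.mono Set.Ioc_subset_Icc_self).aestronglyMeasurable measurableSet_Ioc) C ?_
  rw [ae_restrict_iff' measurableSet_Ioc]
  filter_upwards with s hs
  exact hC s (Set.Ioc_subset_Icc_self hs)

lemma iso_coeff {f : ℝ → ℝ} (hf : IntervalIntegrable f volume 0 1) (n : ℤ) :
    fourierCoeffOn (zero_lt_one' ℝ) (fun s => (f s : ℂ)) n =
      ((∫ s in (0:ℝ)..1, cos (2 * π * n * s) * f s : ℝ) : ℂ)
        - Complex.I * ((∫ s in (0:ℝ)..1, sin (2 * π * n * s) * f s : ℝ) : ℂ) := by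
  have h1 : IntervalIntegrable (fun s => cos (2 * π * n * s) * f s) volume 0 1 :=
    hf.continuousOn_mul (by fun_prop)
  have h2 : IntervalIntegrable (fun s => sin (2 * π * n * s) * f s) volume 0 1 :=
    hf.continuousOn_mul (by fun_prop)
  have h1' : IntervalIntegrable (fun s => ((cos (2 * π * n * s) * f s : ℝ) : ℂ)) volume 0 1 :=
    ⟨h1.1.ofReal, h1.2.ofReal⟩
  have h2' : IntervalIntegrable (fun s => ((sin (2 * π * n * s) * f s : ℝ) : ℂ)) volume 0 1 :=
    ⟨h2.1.ofReal, h2.2.ofReal⟩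
  rw [fourierCoeffOn_eq_integral, ← intervalIntegral.integral_ofReal,
    ← intervalIntegral.integral_ofReal, ← intervalIntegral.integral_const_mul,
    ← intervalIntegral.integral_sub h1' (h2'.const_mul _)]
  simp only [sub_zero, div_one, one_smul]
  apply intervalIntegral.integral_congr
  intro s _
  simp only [smul_eq_mul]
  rw [fourier_coe_apply]
  have : (2 * π * Complex.I * ((-n : ℤ) : ℂ) * s / ((1 - 0 : ℝ) : ℂ))
      = ((-(2 * π * n * s) : ℝ) : ℂ) * Complex.I := by
    push_cast; ring
  rw [this, Complex.exp_mul_I, ← Complex.ofReal_cos, ← Complex.ofReal_sin, cos_neg, sin_neg]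
  push_cast; ring

lemma iso_coeff_deriv {f : ℝ → ℝ} {K : NNReal} (hf : LipschitzOnWith K f (Set.Icc 0 1))
    (h01 : f 0 = f 1) (n : ℤ) :
    fourierCoeffOn (zero_lt_one' ℝ) (fun s => ((deriv f s : ℝ) : ℂ)) n =
      (2 * π * n * Complex.I) * fourierCoeffOn (zero_lt_one' ℝ) (fun s => (f s : ℂ)) n := by
  have hac : AbsolutelyContinuousOnInterval f 0 1 :=
    LipschitzOnWith.absolutelyContinuousOnInterval (K := K)
      (by rwa [Set.uIcc_of_le zero_le_one])
  have hfi : IntervalIntegrable f volume 0 1 := hac.continuousOn.intervalIntegrable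
  have dc : ∀ s : ℝ, HasDerivAt (fun s : ℝ => cos (2 * π * n * s))
      (-(2 * π * n) * sin (2 * π * n * s)) s := fun s => by
    have := ((hasDerivAt_id s).const_mul (2 * π * n)).cos
    simp only [id, mul_one] at this
    convert this using 1; ring
  have ds : ∀ s : ℝ, HasDerivAt (fun s : ℝ => sin (2 * π * n * s))
      ((2 * π * n) * cos (2 * π * n * s)) s := fun s => by
    have := ((hasDerivAt_id s).const_mul (2 * π * n)).sin
    simp only [id, mul_one] at this
    convert this using 1; ring
  have hc : AbsolutelyContinuousOnInterval (fun s : ℝ => cos (2 * π * n * s)) 0 1 := by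
    refine LipschitzOnWith.absolutelyContinuousOnInterval (K := ‖2 * π * n‖₊) ?_
    refine (lipschitzWith_of_nnnorm_deriv_le (fun s => (dc s).differentiableAt) ?_).lipschitzOnWith
    intro s
    rw [(dc s).deriv, ← NNReal.coe_le_coe]
    simp only [coe_nnnorm]
    rw [norm_mul, norm_neg]
    exact mul_le_of_le_one_right (norm_nonneg _) (abs_sin_le_one _)
  have hs : AbsolutelyContinuousOnInterval (fun s : ℝ => sin (2 * π * n * s)) 0 1 := by
    refine LipschitzOnWith.absolutelyContinuousOnInterval (K := ‖2 * π * n‖₊) ?_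
    refine (lipschitzWith_of_nnnorm_deriv_le (fun s => (ds s).differentiableAt) ?_).lipschitzOnWith
    intro s
    rw [(ds s).deriv, ← NNReal.coe_le_coe]
    simp only [coe_nnnorm]
    rw [norm_mul]
    exact mul_le_of_le_one_right (norm_nonneg _) (abs_cos_le_one _)
  have c1 : cos (2 * π * n * 1) = 1 := by
    rw [mul_one, mul_comm]; exact Real.cos_int_mul_two_pi n
  have s1 : sin (2 * π * n * 1) = 0 := by
    have := Real.sin_int_mul_pi (2 * n)
    rw [← this]; push_cast; congr 1; ring
  have e1 := hc.integral_mul_deriv_eq_deriv_mul hac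
  have e2 := hs.integral_mul_deriv_eq_deriv_mul hac
  simp only [(dc _).deriv, (ds _).deriv, c1, s1, mul_zero, cos_zero, sin_zero, h01] at e1 e2
  rw [iso_coeff hac.intervalIntegrable_deriv, iso_coeff hfi]
  simp only [mul_assoc]
  simp only [mul_assoc, intervalIntegral.integral_const_mul] at e1 e2
  rw [e1, e2]
  push_cast
  linear_combination ((2 * π * n : ℂ) * ((∫ s in (0:ℝ)..1, sin (2 * (π * (n * s))) * f s : ℝ) : ℂ))
    * Complex.I_sq

lemma iso_wirtinger {f : ℝ → ℝ} {K : NNReal} (hf : LipschitzOnWith K f (Set.Icc 0 1))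
    (h01 : f 0 = f 1) (h0 : ∫ s in (0:ℝ)..1, f s = 0) :
    4 * π ^ 2 * ∫ s in (0:ℝ)..1, f s ^ 2 ≤ ∫ s in (0:ℝ)..1, deriv f s ^ 2 := by
  have A := hasSum_sq_fourierCoeffOn (zero_lt_one' ℝ) (iso_memLp hf).ofReal (f := fun s => (f s : ℂ))
  have B := hasSum_sq_fourierCoeffOn (zero_lt_one' ℝ) (iso_memLp_deriv hf).ofReal
    (f := fun s => ((deriv f s : ℝ) : ℂ))
  simp only [Complex.norm_real, norm_eq_abs, sq_abs, sub_zero, inv_one, one_smul] at A B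
  refine hasSum_le (fun n => ?_) (A.mul_left (4 * π ^ 2)) B
  rw [iso_coeff_deriv hf h01]
  by_cases hn : n = 0
  · subst hn
    have hfi : IntervalIntegrable f volume 0 1 := by
      refine ContinuousOn.intervalIntegrable ?_
      rw [Set.uIcc_of_le zero_le_one]; exact hf.continuousOn
    rw [iso_coeff hfi]
    simp [h0]
  · rw [norm_mul, mul_pow]
    refine mul_le_mul_of_nonneg_right ?_ (sq_nonneg _)
    have h1 : (1:ℝ) ≤ (n:ℝ) ^ 2 := by
      have : (1:ℤ) ≤ n ^ 2 := by
        have := sq_pos_of_ne_zero hn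
        lia
      exact_mod_cast this
    have : ‖(2 * π * n * Complex.I : ℂ)‖ ^ 2 = 4 * π ^ 2 * (n:ℝ) ^ 2 := by
      simp [mul_pow]; norm_num
    rw [this]
    nlinarith [sq_nonneg π]

lemma iso_pair {f g : ℝ → ℝ} {K : NNReal} (hf : LipschitzOnWith K f (Set.Icc 0 1))
    (hg : LipschitzOnWith K g (Set.Icc 0 1)) (hf01 : f 0 = f 1) (hg01 : g 0 = g 1) :
    2 * π * |∫ s in (0:ℝ)..1, deriv g s * f s| ≤
      ((∫ s in (0:ℝ)..1, deriv f s ^ 2) + ∫ s in (0:ℝ)..1, deriv g s ^ 2) / 2 := by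
  have hgac : AbsolutelyContinuousOnInterval g 0 1 :=
    LipschitzOnWith.absolutelyContinuousOnInterval (K := K)
      (by rwa [Set.uIcc_of_le zero_le_one])
  have hfc : ContinuousOn f (Set.uIcc 0 1) := by
    rw [Set.uIcc_of_le zero_le_one]; exact hf.continuousOn
  have hfi : IntervalIntegrable f volume 0 1 := hfc.intervalIntegrable
  set c := ∫ s in (0:ℝ)..1, f s with hcdef
  have hu : LipschitzOnWith K (fun s => f s - c) (Set.Icc 0 1) := by
    intro a ha b hb
    simpa [edist_dist, dist_eq_norm] using hf ha hb
  have hdu : deriv (fun s => f s - c) = deriv f := by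
    funext s; exact deriv_sub_const c
  have W := iso_wirtinger hu (by simp [hf01]) (by
    rw [intervalIntegral.integral_sub hfi (by simp)]; simp [← hcdef])
  rw [hdu] at W
  have hucont : ContinuousOn (fun s => f s - c) (Set.uIcc 0 1) := hfc.sub continuousOn_const
  have hdgi := hgac.intervalIntegrable_deriv
  have hE : ∫ s in (0:ℝ)..1, deriv g s * f s = ∫ s in (0:ℝ)..1, deriv g s * (f s - c) := by
    have : ∫ s in (0:ℝ)..1, deriv g s * c = 0 := by
      rw [intervalIntegral.integral_mul_const, hgac.integral_deriv_eq_sub, hg01]; simp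
    simp only [mul_sub]
    rw [intervalIntegral.integral_sub (hdgi.mul_continuousOn hfc) (hdgi.mul_const c), this,
      sub_zero]
  have hI : IntervalIntegrable (fun s => deriv g s * (f s - c)) volume 0 1 :=
    hdgi.mul_continuousOn hucont
  have hu2 : IntervalIntegrable (fun s => (f s - c) ^ 2) volume 0 1 :=
    (hucont.pow 2).intervalIntegrable
  have hg2 : IntervalIntegrable (fun s => deriv g s ^ 2) volume 0 1 := by
    rw [intervalIntegrable_iff_integrableOn_Ioc_of_le zero_le_one]
    exact (iso_memLp_deriv hg).integrable_sq
  have key : ∀ σ : ℝ, σ ^ 2 = 1 → 2 * π * (σ * ∫ s in (0:ℝ)..1, deriv g s * (f s - c)) ≤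
      (4 * π ^ 2 * (∫ s in (0:ℝ)..1, (f s - c) ^ 2) + ∫ s in (0:ℝ)..1, deriv g s ^ 2) / 2 := by
    intro σ hσ
    have := intervalIntegral.integral_mono_on (zero_le_one' ℝ) (hI.const_mul (4 * π * σ))
      ((hu2.const_mul (4 * π ^ 2)).add hg2) (fun s _ => by
        have := sq_nonneg (2 * π * (f s - c) - σ * deriv g s)
        have h2 : (2 * π * (f s - c) - σ * deriv g s) ^ 2 = 4 * π ^ 2 * (f s - c) ^ 2
          + deriv g s ^ 2 - 4 * π * σ * (deriv g s * (f s - c)) := by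
          linear_combination (deriv g s) ^ 2 * hσ
        linarith)
    rw [intervalIntegral.integral_add (hu2.const_mul (4 * π ^ 2)) hg2,
      intervalIntegral.integral_const_mul, intervalIntegral.integral_const_mul] at this
    linarith
  rw [hE]
  rcases abs_cases (∫ s in (0:ℝ)..1, deriv g s * (f s - c)) with ⟨h, _⟩ | ⟨h, _⟩
  · rw [h]; linarith [key 1 (by norm_num)]
  · rw [h]; linarith [key (-1) (by norm_num)]




/-- Isoperimetric inequality for closed constant-speed curves in `ℝ^{2n}`:
`L² ≥ 4π|𝔇|` where `𝔇` is the sum of the signed areas enclosed by the planar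
projections of the curve. -/
theorem isoperimetric_R2n
    (n : ℕ) (x y : Fin n → ℝ → ℝ) (L : ℝ) (hL : 0 ≤ L) (K : NNReal)
    (hx : ∀ j, LipschitzOnWith K (x j) (Set.Icc 0 1))
    (hy : ∀ j, LipschitzOnWith K (y j) (Set.Icc 0 1))
    (hclosed : ∀ j, x j 0 = x j 1 ∧ y j 0 = y j 1)
    (hspeed : ∀ᵐ s ∂(volume.restrict (Set.Icc (0:ℝ) 1)),
      ∑ j, ((deriv (x j) s) ^ 2 + (deriv (y j) s) ^ 2) = L ^ 2) :
    L ^ 2 ≥ 4 * π *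
      |∑ j, (1 / 2) * ∫ s in (0:ℝ)..1,
        (deriv (y j) s * x j s - deriv (x j) s * y j s)| := by

  have hii : ∀ {f : ℝ → ℝ}, LipschitzOnWith K f (Set.Icc 0 1) →
      IntervalIntegrable (fun s => deriv f s ^ 2) volume 0 1 := fun hf => by
    rw [intervalIntegrable_iff_integrableOn_Ioc_of_le zero_le_one]
    exact (iso_memLp_deriv hf).integrable_sq
  have hprod : ∀ {f g : ℝ → ℝ}, LipschitzOnWith K f (Set.Icc 0 1) →
      LipschitzOnWith K g (Set.Icc 0 1) →
      IntervalIntegrable (fun s => deriv g s * f s) volume 0 1 := fun hf hg => by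
    have hgac : AbsolutelyContinuousOnInterval _ 0 1 :=
      LipschitzOnWith.absolutelyContinuousOnInterval (K := K)
        (by rwa [Set.uIcc_of_le zero_le_one])
    refine hgac.intervalIntegrable_deriv.mul_continuousOn ?_
    rw [Set.uIcc_of_le zero_le_one]; exact hf.continuousOn
  have hsum : ∑ j, ((∫ s in (0:ℝ)..1, deriv (x j) s ^ 2) + ∫ s in (0:ℝ)..1, deriv (y j) s ^ 2)
      = L ^ 2 := by
    have e : ∀ j, ((∫ s in (0:ℝ)..1, deriv (x j) s ^ 2) + ∫ s in (0:ℝ)..1, deriv (y j) s ^ 2)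
        = ∫ s in (0:ℝ)..1, (deriv (x j) s ^ 2 + deriv (y j) s ^ 2) := fun j =>
      (intervalIntegral.integral_add (hii (hx j)) (hii (hy j))).symm
    simp only [e]
    rw [← intervalIntegral.integral_finsetSum (fun j _ => (hii (hx j)).add (hii (hy j)))]
    have : ∫ s in (0:ℝ)..1, ∑ j, (deriv (x j) s ^ 2 + deriv (y j) s ^ 2)
        = ∫ s in (0:ℝ)..1, L ^ 2 := by
      apply intervalIntegral.integral_congr_ae
      rw [ae_restrict_iff' measurableSet_Icc] at hspeed
      filter_upwards [hspeed] with s hs h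
      rw [Set.uIoc_of_le zero_le_one] at h
      exact hs (Set.Ioc_subset_Icc_self h)
    rw [this]; simp
  rw [← hsum, ge_iff_le]
  refine (mul_le_mul_of_nonneg_left (Finset.abs_sum_le_sum_abs _ _) (by positivity)).trans ?_
  rw [Finset.mul_sum]
  refine Finset.sum_le_sum fun j _ => ?_
  rw [intervalIntegral.integral_sub (hprod (hx j) (hy j)) (hprod (hy j) (hx j)), abs_mul]
  have p1 := iso_pair (hx j) (hy j) (hclosed j).1 (hclosed j).2
  have p2 := iso_pair (hy j) (hx j) (hclosed j).2 (hclosed j).1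
  have t := mul_le_mul_of_nonneg_left (abs_sub (∫ s in (0:ℝ)..1, deriv (y j) s * x j s)
    (∫ s in (0:ℝ)..1, deriv (x j) s * y j s)) (by positivity : 0 ≤ 2 * π)
  rw [abs_of_pos (by norm_num : (0:ℝ) < 1 / 2)]
  linarith
end

section
/- Let γ : [0,1] → ℂⁿ be a closed Lipschitz curve with constant speed L and sum of projected signed areas 𝔇. Equality L² = 4π𝔇 holds if and only if there exist points P, Q ∈ ℂⁿ with γ(s) = Q + (1 − e^{2πis})P for all s ∈ [0,1]. -/
open Real MeasureTheory

namespace IsoAux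

/-- Fourier coefficients on `[0,1]`. -/
noncomputable def cf (f : ℝ → ℂ) (k : ℤ) : ℂ :=
  ∫ s in (0:ℝ)..1, Complex.exp (-(2 * π * Complex.I * k) * s) * f s

lemma cf_eq (f : ℝ → ℂ) (k : ℤ) : fourierCoeffOn zero_lt_one f k = cf f k := by
  rw [fourierCoeffOn_eq_integral, cf]
  simp only [sub_zero, div_one, one_smul, smul_eq_mul, fourier_coe_apply]
  congr 1
  ext s
  congr 2
  push_cast
  ring

lemma parseval {f : ℝ → ℂ} (hf : MemLp f 2 (volume.restrict (Set.Ioc 0 1))) :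
    HasSum (fun k => ‖cf f k‖ ^ 2) (∫ s in (0:ℝ)..1, ‖f s‖ ^ 2) := by
  have h := hasSum_sq_fourierCoeffOn zero_lt_one hf
  simpa [cf_eq] using h

lemma ac_re {F : ℝ → ℂ} (hF : AbsolutelyContinuousOnInterval F 0 1) :
    AbsolutelyContinuousOnInterval (fun s => (F s).re) 0 1 := by
  rw [absolutelyContinuousOnInterval_iff] at hF ⊢
  intro ε hε
  obtain ⟨δ, hδ, h⟩ := hF ε hε
  refine ⟨δ, hδ, fun E hE hl => lt_of_le_of_lt (Finset.sum_le_sum fun i _ => ?_) (h E hE hl)⟩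
  rw [Real.dist_eq, Complex.dist_eq, ← Complex.sub_re]
  exact Complex.abs_re_le_norm _

lemma ac_im {F : ℝ → ℂ} (hF : AbsolutelyContinuousOnInterval F 0 1) :
    AbsolutelyContinuousOnInterval (fun s => (F s).im) 0 1 := by
  rw [absolutelyContinuousOnInterval_iff] at hF ⊢
  intro ε hε
  obtain ⟨δ, hδ, h⟩ := hF ε hε
  refine ⟨δ, hδ, fun E hE hl => lt_of_le_of_lt (Finset.sum_le_sum fun i _ => ?_) (h E hE hl)⟩
  rw [Real.dist_eq, Complex.dist_eq, ← Complex.sub_im]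
  exact Complex.abs_im_le_norm _

lemma hasDerivAt_re {F : ℝ → ℂ} {D : ℂ} {x : ℝ} (h : HasDerivAt F D x) :
    HasDerivAt (fun s => (F s).re) D.re x :=
  Complex.reCLM.hasFDerivAt.comp_hasDerivAt x h

lemma hasDerivAt_im {F : ℝ → ℂ} {D : ℂ} {x : ℝ} (h : HasDerivAt F D x) :
    HasDerivAt (fun s => (F s).im) D.im x :=
  Complex.imCLM.hasFDerivAt.comp_hasDerivAt x h

lemma ftcC {F G : ℝ → ℂ} (hF : AbsolutelyContinuousOnInterval F 0 1)
    (hG : ∀ᵐ x, x ∈ Set.Ioc (0:ℝ) 1 → HasDerivAt F (G x) x) :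
    ∫ s in (0:ℝ)..1, G s = F 1 - F 0 := by
  have hr := (ac_re hF).integral_deriv_eq_sub
  have hi := (ac_im hF).integral_deriv_eq_sub
  have e : ∫ s in (0:ℝ)..1, G s = ∫ s in (0:ℝ)..1,
      (((deriv (fun s => (F s).re) s : ℝ) : ℂ) +
        ((deriv (fun s => (F s).im) s : ℝ) : ℂ) * Complex.I) := by
    apply intervalIntegral.integral_congr_ae
    filter_upwards [hG] with x hx hm
    rw [Set.uIoc_of_le zero_le_one] at hm
    rw [(hasDerivAt_re (hx hm)).deriv, (hasDerivAt_im (hx hm)).deriv, Complex.re_add_im]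
  have i1 := (ac_re hF).intervalIntegrable_deriv
  have i2 := (ac_im hF).intervalIntegrable_deriv
  rw [e, intervalIntegral.integral_add, intervalIntegral.integral_mul_const,
    intervalIntegral.integral_ofReal, intervalIntegral.integral_ofReal, hr, hi]
  · apply Complex.ext <;> simp
  · exact ⟨i1.1.ofReal, i1.2.ofReal⟩
  · exact IntervalIntegrable.mul_const ⟨i2.1.ofReal, i2.2.ofReal⟩ _

lemma exp_one (k : ℤ) : Complex.exp (-(2 * π * Complex.I * k)) = 1 := by
  have := Complex.exp_int_mul_two_pi_mul_I (-k)
  rw [← this]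
  congr 1
  push_cast
  ring

lemma exp_hasDeriv (c : ℂ) (x : ℝ) :
    HasDerivAt (fun s : ℝ => Complex.exp (c * s)) (c * Complex.exp (c * x)) x := by
  have h := ((hasDerivAt_id (x : ℂ)).const_mul c).cexp.comp_ofReal
  simpa [mul_comm] using h

lemma exp_ac (c : ℂ) :
    AbsolutelyContinuousOnInterval (fun s : ℝ => Complex.exp (c * s)) 0 1 := by
  apply ContDiffOn.absolutelyContinuousOnInterval
  apply ContDiff.contDiffOn
  exact (contDiff_const.mul Complex.ofRealCLM.contDiff).cexp

section scalar
variable {f : ℝ → ℂ} {K : NNReal}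

lemma ae_diff (hf : LipschitzOnWith K f (Set.Icc 0 1)) :
    ∀ᵐ x, x ∈ Set.Ioc (0:ℝ) 1 → HasDerivAt f (deriv f x) x := by
  have h1 : ∀ᵐ x : ℝ, x ≠ 1 := by simp [ae_iff, measure_singleton]
  filter_upwards [hf.ae_differentiableWithinAt_of_mem_real, h1] with x hx h1 hm
  have := (hx ⟨hm.1.le, hm.2⟩).differentiableAt (Icc_mem_nhds hm.1 (lt_of_le_of_ne hm.2 h1))
  exact this.hasDerivAt

lemma memLp_deriv (hf : LipschitzOnWith K f (Set.Icc 0 1)) :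
    MemLp (deriv f) 2 (volume.restrict (Set.Ioc 0 1)) := by
  apply MemLp.of_bound (C := K) (measurable_deriv f).aestronglyMeasurable
  have h1 : ∀ᵐ x : ℝ, x ≠ 1 := by simp [ae_iff, measure_singleton]
  rw [ae_restrict_iff' measurableSet_Ioc]
  filter_upwards [h1] with x h1 hm
  exact norm_deriv_le_of_lipschitzOn (Icc_mem_nhds hm.1 (lt_of_le_of_ne hm.2 h1)) hf

lemma memLp_cont {f : ℝ → ℂ} (hf : ContinuousOn f (Set.Icc 0 1)) :
    MemLp f 2 (volume.restrict (Set.Ioc 0 1)) := by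
  obtain ⟨C, hC⟩ := isCompact_Icc.exists_bound_of_continuousOn hf
  apply MemLp.of_bound (C := C)
  · exact (hf.mono Set.Ioc_subset_Icc_self).aestronglyMeasurable measurableSet_Ioc
  · rw [ae_restrict_iff' measurableSet_Ioc]
    exact Filter.Eventually.of_forall fun x hm => hC x ⟨hm.1.le, hm.2⟩

lemma intg {f : ℝ → ℂ} (hf : MemLp f 2 (volume.restrict (Set.Ioc 0 1))) :
    IntervalIntegrable f volume 0 1 := by
  rw [intervalIntegrable_iff_integrableOn_Ioc_of_le zero_le_one]
  exact hf.integrable (by norm_num)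

lemma intg_e {f : ℝ → ℂ} (hf : MemLp f 2 (volume.restrict (Set.Ioc 0 1))) (c : ℂ) :
    IntervalIntegrable (fun s : ℝ => Complex.exp (c * s) * f s) volume 0 1 :=
  (intg hf).continuousOn_mul (exp_ac c).continuousOn

lemma cf_sub {f g : ℝ → ℂ} (hf : MemLp f 2 (volume.restrict (Set.Ioc 0 1)))
    (hg : MemLp g 2 (volume.restrict (Set.Ioc 0 1))) (k : ℤ) :
    cf (fun s => f s - g s) k = cf f k - cf g k := by
  simp only [cf, mul_sub]
  exact intervalIntegral.integral_sub (intg_e hf _) (intg_e hg _)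

lemma cf_const_mul (f : ℝ → ℂ) (c : ℂ) (k : ℤ) :
    cf (fun s => c * f s) k = c * cf f k := by
  simp only [cf]
  rw [← intervalIntegral.integral_const_mul]
  congr 1
  ext s
  ring

lemma cf_deriv (hf : LipschitzOnWith K f (Set.Icc 0 1)) (h01 : f 0 = f 1) (k : ℤ) :
    cf (deriv f) k = 2 * π * Complex.I * k * cf f k := by
  set c : ℂ := -(2 * π * Complex.I * k) with hc
  have hac : AbsolutelyContinuousOnInterval (fun s => Complex.exp (c * s) * f s) 0 1 := by
    have hf' : LipschitzOnWith K f (Set.uIcc 0 1) := by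
      rwa [Set.uIcc_of_le zero_le_one]
    exact (exp_ac c).smul hf'.absolutelyContinuousOnInterval
  have h := ftcC (G := fun s => c * (Complex.exp (c * s) * f s) + Complex.exp (c * s) * deriv f s)
    hac (by
      filter_upwards [ae_diff hf] with x hx hm
      convert! (exp_hasDeriv c x).mul (hx hm) using 1
      ring)
  rw [intervalIntegral.integral_add ((intg_e (memLp_cont hf.continuousOn) c).const_mul c)
    (intg_e (memLp_deriv hf) c), intervalIntegral.integral_const_mul] at h
  have e1 : Complex.exp c = 1 := exp_one k
  simp only [Complex.ofReal_one, mul_one, Complex.ofReal_zero, mul_zero, Complex.exp_zero, e1,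
    h01, sub_self] at h
  have : c * cf f k + cf (deriv f) k = 0 := h
  rw [eq_neg_of_add_eq_zero_right this, hc]
  ring

/-- The deficit of a single projection. -/
noncomputable def E (f : ℝ → ℂ) : ℝ :=
  ∫ s in (0:ℝ)..1, (‖deriv f s‖ ^ 2 - 2 * π * ((deriv f s).im * (f s).re - (deriv f s).re * (f s).im))

lemma intg_sq {f : ℝ → ℂ} (hf : MemLp f 2 (volume.restrict (Set.Ioc 0 1))) :
    IntervalIntegrable (fun s => ‖f s‖ ^ 2) volume 0 1 := by
  rw [intervalIntegrable_iff_integrableOn_Ioc_of_le zero_le_one]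
  exact hf.integrable_norm_pow (by norm_num)

lemma hasSum_E (hf : LipschitzOnWith K f (Set.Icc 0 1)) (h01 : f 0 = f 1) :
    HasSum (fun k : ℤ => π ^ 2 * ((2 * (k:ℝ) - 1) ^ 2 - 1) * ‖cf f k‖ ^ 2) (E f) := by
  have m1 := memLp_deriv hf
  have m2 := memLp_cont hf.continuousOn
  have m3 : MemLp (fun s => (π * Complex.I) * f s) 2 (volume.restrict (Set.Ioc 0 1)) :=
    m2.const_mul _
  have m4 : MemLp (fun s => deriv f s - (π * Complex.I) * f s) 2
    (volume.restrict (Set.Ioc 0 1)) := m1.sub m3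
  have p1 := parseval m4
  have p2 := (parseval m2).mul_left (π ^ 2)
  have p := p1.sub p2
  rw [← intervalIntegral.integral_const_mul, ← intervalIntegral.integral_sub (intg_sq m4)
    ((intg_sq m2).const_mul _)] at p
  convert! p using 1
  · ext k
    rw [cf_sub m1 m3, cf_const_mul, cf_deriv hf h01]
    have : 2 * π * Complex.I * k * cf f k - π * Complex.I * cf f k
      = ((π * (2 * (k:ℝ) - 1) : ℝ) : ℂ) * Complex.I * cf f k := by
      push_cast; ring
    rw [this, norm_mul, norm_mul, Complex.norm_I, Complex.norm_real, mul_one, mul_pow,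
      Real.norm_eq_abs, sq_abs]
    ring
  · rw [E]
    congr 1
    ext s
    simp only [← Complex.normSq_eq_norm_sq, Complex.normSq_apply]
    simp
    ring

lemma term_nonneg (k : ℤ) : 0 ≤ (2 * (k:ℝ) - 1) ^ 2 - 1 := by
  have : (0:ℤ) ≤ k * (k - 1) := by
    rcases le_or_gt k 0 with h | h
    · nlinarith
    · nlinarith
  have : (0:ℝ) ≤ k * (k - 1) := by exact_mod_cast this
  nlinarith

lemma term_zero {k : ℤ} (h : (2 * (k:ℝ) - 1) ^ 2 - 1 = 0) : k = 0 ∨ k = 1 := by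
  have : (k:ℝ) * (k - 1) = 0 := by nlinarith
  have : k * (k - 1) = 0 := by exact_mod_cast this
  rcases mul_eq_zero.1 this with h | h
  · exact Or.inl h
  · exact Or.inr (by omega)

lemma E_nonneg (hf : LipschitzOnWith K f (Set.Icc 0 1)) (h01 : f 0 = f 1) : 0 ≤ E f :=
  (hasSum_E hf h01).nonneg fun k =>
    mul_nonneg (mul_nonneg (sq_nonneg _) (term_nonneg k)) (sq_nonneg _)

lemma E_zero_iff (hf : LipschitzOnWith K f (Set.Icc 0 1)) (h01 : f 0 = f 1) :
    E f = 0 ↔ ∀ k : ℤ, k ≠ 0 → k ≠ 1 → cf f k = 0 := by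
  have h := hasSum_E hf h01
  constructor
  · intro h0 k k0 k1
    rw [h0, hasSum_zero_iff_of_nonneg fun k =>
      mul_nonneg (mul_nonneg (sq_nonneg _) (term_nonneg k)) (sq_nonneg _)] at h
    have := congrFun h k
    simp only [Pi.zero_apply, mul_eq_zero] at this
    rcases this with (h | h) | h
    · exact absurd h (by positivity)
    · rcases term_zero h with h | h <;> contradiction
    · simpa using h
  · intro h0
    refine h.unique ?_
    convert! hasSum_zero with k
    by_cases k0 : k = 0
    · subst k0; norm_num
    by_cases k1 : k = 1
    · subst k1; norm_num
    rw [h0 k k0 k1]; simp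

lemma int_exp (m : ℤ) :
    ∫ s in (0:ℝ)..1, Complex.exp (-(2 * π * Complex.I * m) * s) = if m = 0 then 1 else 0 := by
  split_ifs with h
  · subst h; simp
  · rw [integral_exp_mul_complex]
    · simp [exp_one]
    · simp [h, Real.pi_ne_zero]

lemma cf_circle (a b : ℂ) (k : ℤ) :
    cf (fun s => a + b * Complex.exp (2 * π * Complex.I * s)) k =
      (if k = 0 then a else 0) + (if k = 1 then b else 0) := by
  have : ∀ s : ℝ, Complex.exp (-(2 * π * Complex.I * k) * s) *
      (a + b * Complex.exp (2 * π * Complex.I * s)) =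
      a * Complex.exp (-(2 * π * Complex.I * k) * s) +
      b * Complex.exp (-(2 * π * Complex.I * ((k - 1 : ℤ) : ℂ)) * s) := by
    intro s
    have : -(2 * π * Complex.I * ((k - 1 : ℤ) : ℂ)) * s =
      -(2 * π * Complex.I * k) * s + 2 * π * Complex.I * s := by push_cast; ring
    rw [this, Complex.exp_add]
    ring
  simp only [cf, this]
  rw [intervalIntegral.integral_add, intervalIntegral.integral_const_mul,
    intervalIntegral.integral_const_mul, int_exp, int_exp]
  · simp [sub_eq_zero]
  · exact (exp_ac _).continuousOn.intervalIntegrable.const_mul _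
  · exact (exp_ac _).continuousOn.intervalIntegrable.const_mul _

lemma cont_circle (a b : ℂ) :
    Continuous (fun s : ℝ => a + b * Complex.exp (2 * π * Complex.I * s)) := by
  fun_prop

lemma eq_circle (hf : LipschitzOnWith K f (Set.Icc 0 1))
    (h : ∀ k : ℤ, k ≠ 0 → k ≠ 1 → cf f k = 0) :
    ∀ s ∈ Set.Icc (0:ℝ) 1, f s = cf f 0 + cf f 1 * Complex.exp (2 * π * Complex.I * s) := by
  have m1 := memLp_cont hf.continuousOn
  have m2 := memLp_cont (cont_circle (cf f 0) (cf f 1)).continuousOn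
  have p := parseval (m1.sub m2)
  have z : ∀ k, cf (f - fun s : ℝ => cf f 0 + cf f 1 * Complex.exp (2 * π * Complex.I * s)) k = 0 := by
    intro k
    have := cf_sub m1 m2 k
    rw [cf_circle] at this
    refine this.trans ?_
    by_cases k0 : k = 0
    · subst k0; simp
    by_cases k1 : k = 1
    · subst k1; simp
    simp [k0, k1, h k k0 k1]
  simp only [z, norm_zero, ne_eq, OfNat.ofNat_ne_zero, not_false_eq_true, zero_pow] at p
  have p0 := p.unique hasSum_zero
  by_contra! hne
  obtain ⟨s, hs, hne⟩ := hne
  have pos := intervalIntegral.integral_pos (a := 0) (b := 1) zero_lt_one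
    (f := fun s => ‖(f - fun s : ℝ => cf f 0 + cf f 1 * Complex.exp (2 * π * Complex.I * s)) s‖ ^ 2)
    (((hf.continuousOn.sub (cont_circle (cf f 0) (cf f 1)).continuousOn).norm).pow 2)
    (fun x _ => by positivity) ⟨s, hs, by
      have : (f - fun s : ℝ => cf f 0 + cf f 1 * Complex.exp (2 * π * Complex.I * s)) s ≠ 0 :=
        sub_ne_zero.2 hne
      positivity⟩
  linarith

lemma E_zero_iff_circle (hf : LipschitzOnWith K f (Set.Icc 0 1)) (h01 : f 0 = f 1) :
    E f = 0 ↔ ∃ P Q : ℂ, ∀ s ∈ Set.Icc (0:ℝ) 1,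
      f s = Q + (1 - Complex.exp (2 * π * Complex.I * s)) * P := by
  rw [E_zero_iff hf h01]
  constructor
  · intro h
    refine ⟨-cf f 1, cf f 0 + cf f 1, fun s hs => ?_⟩
    rw [eq_circle hf h s hs]
    ring
  · rintro ⟨P, Q, h⟩ k k0 k1
    have e : cf f k = cf (fun s => (Q + P) + (-P) * Complex.exp (2 * π * Complex.I * s)) k := by
      unfold cf
      apply intervalIntegral.integral_congr
      intro s hs
      rw [Set.uIcc_of_le zero_le_one] at hs
      simp only [h s hs]
      ring
    rw [e, cf_circle]
    simp [k0, k1]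

lemma intg_area (hf : LipschitzOnWith K f (Set.Icc 0 1)) :
    IntervalIntegrable (fun s => (deriv f s).im * (f s).re - (deriv f s).re * (f s).im)
      volume 0 1 := by
  have i := intg (memLp_deriv hf)
  have c : ContinuousOn f (Set.uIcc 0 1) := by
    rw [Set.uIcc_of_le zero_le_one]; exact hf.continuousOn
  have ir : IntervalIntegrable (fun s => (deriv f s).re) volume 0 1 := ⟨i.1.re, i.2.re⟩
  have ii : IntervalIntegrable (fun s => (deriv f s).im) volume 0 1 := ⟨i.1.im, i.2.im⟩
  exact (ii.mul_continuousOn (Complex.continuous_re.comp_continuousOn c)).sub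
    (ir.mul_continuousOn (Complex.continuous_im.comp_continuousOn c))

lemma area_eq (hf : LipschitzOnWith K f (Set.Icc 0 1)) :
    ∫ s in (0:ℝ)..1, (deriv (fun τ => (f τ).im) s * (f s).re
          - deriv (fun τ => (f τ).re) s * (f s).im) =
    ∫ s in (0:ℝ)..1, ((deriv f s).im * (f s).re - (deriv f s).re * (f s).im) := by
  apply intervalIntegral.integral_congr_ae
  filter_upwards [ae_diff hf] with x hx hm
  rw [Set.uIoc_of_le zero_le_one] at hm
  rw [(hasDerivAt_re (hx hm)).deriv, (hasDerivAt_im (hx hm)).deriv]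

lemma E_eq (hf : LipschitzOnWith K f (Set.Icc 0 1)) :
    E f = (∫ s in (0:ℝ)..1, ‖deriv f s‖ ^ 2) - 2 * π *
      ∫ s in (0:ℝ)..1, (deriv (fun τ => (f τ).im) s * (f s).re
          - deriv (fun τ => (f τ).re) s * (f s).im) := by
  rw [area_eq hf, E, intervalIntegral.integral_sub (intg_sq (memLp_deriv hf))
    ((intg_area hf).const_mul _), intervalIntegral.integral_const_mul]

end scalar

end IsoAux

/-- Equality case of the isoperimetric inequality in `ℂⁿ`: for a closed
Lipschitz curve of constant speed `L`, `L² = 4π𝔇` holds if and only if the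
curve is of the form `γ(s) = Q + (1 - e^{2πis})P`. -/
theorem isoperimetric_equality_iff_circle
    (n : ℕ) (γ : ℝ → Fin n → ℂ) (L : ℝ) (hL : 0 ≤ L) (K : NNReal)
    (hγ : ∀ j, LipschitzOnWith K (fun s => γ s j) (Set.Icc 0 1))
    (hclosed : γ 0 = γ 1)
    (hspeed : ∀ᵐ s ∂(volume.restrict (Set.Icc (0:ℝ) 1)),
      ∑ j, ((deriv (fun τ => (γ τ j).re) s) ^ 2
        + (deriv (fun τ => (γ τ j).im) s) ^ 2) = L ^ 2) :
    L ^ 2 = 4 * π * (∑ j, (1 / 2) * ∫ s in (0:ℝ)..1,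
        (deriv (fun τ => (γ τ j).im) s * (γ s j).re
          - deriv (fun τ => (γ τ j).re) s * (γ s j).im)) ↔
      ∃ P Q : Fin n → ℂ, ∀ s ∈ Set.Icc (0:ℝ) 1,
        γ s = fun j => Q j + (1 - Complex.exp (2 * π * Complex.I * s)) * P j := by
  have h01 : ∀ j, γ 0 j = γ 1 j := fun j => congrFun hclosed j
  have hLen : ∑ j, ∫ s in (0:ℝ)..1, ‖deriv (fun τ => γ τ j) s‖ ^ 2 = L ^ 2 := by
    rw [← intervalIntegral.integral_finsetSum
      (fun j _ => IsoAux.intg_sq (IsoAux.memLp_deriv (hγ j)))]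
    have : ∫ s in (0:ℝ)..1, L ^ 2 = L ^ 2 := by simp
    rw [← this]
    apply intervalIntegral.integral_congr_ae
    rw [ae_restrict_iff' measurableSet_Icc] at hspeed
    have hd : ∀ᵐ x, ∀ j, x ∈ Set.Ioc (0:ℝ) 1 →
        HasDerivAt (fun τ => γ τ j) (deriv (fun τ => γ τ j) x) x :=
      ae_all_iff.2 fun j => IsoAux.ae_diff (hγ j)
    filter_upwards [hspeed, hd] with x hx hd hm
    rw [Set.uIoc_of_le zero_le_one] at hm
    rw [← hx ⟨hm.1.le, hm.2⟩]
    refine Finset.sum_congr rfl fun j _ => ?_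
    rw [(IsoAux.hasDerivAt_re (hd j hm)).deriv, (IsoAux.hasDerivAt_im (hd j hm)).deriv,
      ← Complex.normSq_eq_norm_sq, Complex.normSq_apply]
    ring
  have hE : L ^ 2 - 4 * π * (∑ j, (1 / 2) * ∫ s in (0:ℝ)..1,
        (deriv (fun τ => (γ τ j).im) s * (γ s j).re
          - deriv (fun τ => (γ τ j).re) s * (γ s j).im)) = ∑ j, IsoAux.E (fun τ => γ τ j) := by
    rw [Finset.sum_congr rfl fun j _ => IsoAux.E_eq (hγ j), Finset.sum_sub_distrib, hLen,
      ← Finset.mul_sum, ← Finset.mul_sum]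
    ring
  rw [← sub_eq_zero, hE, Finset.sum_eq_zero_iff_of_nonneg
    (fun j _ => IsoAux.E_nonneg (hγ j) (h01 j))]
  constructor
  · intro h
    have h' := fun j => (IsoAux.E_zero_iff_circle (hγ j) (h01 j)).1 (h j (Finset.mem_univ j))
    choose P Q hPQ using h'
    exact ⟨P, Q, fun s hs => funext fun j => hPQ j s hs⟩
  · rintro ⟨P, Q, h⟩ j _
    exact (IsoAux.E_zero_iff_circle (hγ j) (h01 j)).2
      ⟨P j, Q j, fun s hs => congrFun (h s hs) j⟩
end

section
/- Let Γ = (γ, t) : [0,1] → ℍⁿ be a horizontal curve of constant horizontal speed with Γ(0) = (0,0,0) and Γ(1) = (0,0,T), T > 0, and let L be its horizontal length. Then L² ≥ πT. -/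
open Real MeasureTheory

/-- Isoperimetric-type inequality on a piece of curve whose endpoints lie on a common line
through the origin. -/
lemma half_ineq {x y : ℝ → ℝ} {a b ω p q : ℝ} (hab : a < b)
    (hx : AbsolutelyContinuousOnInterval x a b)
    (hy : AbsolutelyContinuousOnInterval y a b)
    (hx2 : IntervalIntegrable (fun s => deriv x s ^ 2) volume a b)
    (hy2 : IntervalIntegrable (fun s => deriv y s ^ 2) volume a b)
    (hpq : p ^ 2 + q ^ 2 = 1) (hva : p * y a - q * x a = 0) (hvb : p * y b - q * x b = 0)
    (hω : 0 < ω) (hωb : ω * (b - a) < π) :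
    ω * ∫ s in a..b, (deriv x s * y s - x s * deriv y s) ≤
      ∫ s in a..b, (deriv x s ^ 2 + deriv y s ^ 2) := by
  have hcos : ∀ s ∈ Set.uIcc a b, 0 < cos (ω * (s - (a + b) / 2)) := by
    intro s hs
    rw [Set.uIcc_of_le hab.le] at hs
    apply cos_pos_of_mem_Ioo
    constructor <;> nlinarith [hs.1, hs.2]
  set τ : ℝ → ℝ := fun s => ω * tan (ω * (s - (a + b) / 2)) with hτ
  have hτd : ∀ s ∈ Set.uIcc a b, HasDerivAt τ (ω ^ 2 + τ s ^ 2) s := by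
    intro s hs
    have hc := (hcos s hs).ne'
    have h1 : HasDerivAt (fun s : ℝ => ω * (s - (a + b) / 2)) ω s := by
      simpa using ((hasDerivAt_id s).sub_const ((a + b) / 2)).const_mul ω
    have h2 := ((Real.hasDerivAt_tan hc).comp s h1).const_mul ω
    refine h2.congr_deriv ?_
    simp only [hτ]
    rw [tan_eq_sin_div_cos]
    have hsc := sin_sq_add_cos_sq (ω * (s - (a + b) / 2))
    generalize cos (ω * (s - (a + b) / 2)) = C at *
    generalize sin (ω * (s - (a + b) / 2)) = S at *
    field_simp
    linarith
  have hτac : AbsolutelyContinuousOnInterval τ a b := by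
    apply ContDiffOn.absolutelyContinuousOnInterval
    intro s hs
    have hc := (hcos s hs).ne'
    apply ContDiffAt.contDiffWithinAt
    have h1 : ContDiffAt ℝ 1 (fun s : ℝ => ω * (s - (a + b) / 2)) s := by fun_prop
    have h2 : ContDiffAt ℝ 1 (tan ∘ fun s : ℝ => ω * (s - (a + b) / 2)) s :=
      ContDiffAt.comp s (Real.contDiffAt_tan.2 hc) h1
    exact contDiffAt_const.mul h2
  set v : ℝ → ℝ := fun s => p * y s - q * x s with hv
  set u : ℝ → ℝ := fun s => p * x s + q * y s with hu
  have hvac : AbsolutelyContinuousOnInterval v a b := (hy.const_mul p).fun_sub (hx.const_mul q)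
  have huac : AbsolutelyContinuousOnInterval u a b := (hx.const_mul p).fun_add (hy.const_mul q)
  set G : ℝ → ℝ := fun s => τ s * (v s * v s) + (-ω) * (u s * v s) with hG
  have hGac : AbsolutelyContinuousOnInterval G a b :=
    (hτac.fun_mul (hvac.fun_mul hvac)).fun_add ((huac.fun_mul hvac).const_mul (-ω))
  have hGint : ∫ s in a..b, deriv G s = 0 := by
    rw [hGac.integral_deriv_eq_sub]
    simp only [hG, hv, hva, hvb]
    ring
  have hI1 : IntervalIntegrable (fun s => deriv x s ^ 2 + deriv y s ^ 2) volume a b := hx2.add hy2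
  have hI2 : IntervalIntegrable (fun s => deriv x s * y s - x s * deriv y s) volume a b :=
    (hx.intervalIntegrable_deriv.mul_continuousOn hy.continuousOn).sub
      (hy.intervalIntegrable_deriv.continuousOn_mul hx.continuousOn)
  have hI3 := hGac.intervalIntegrable_deriv
  have key : 0 ≤ ∫ s in a..b, ((deriv x s ^ 2 + deriv y s ^ 2)
      - ω * (deriv x s * y s - x s * deriv y s) + deriv G s) := by
    apply intervalIntegral.integral_nonneg_of_ae_restrict hab.le
    rw [Filter.EventuallyLE, ae_restrict_iff' measurableSet_Icc]
    filter_upwards [hx.ae_differentiableAt, hy.ae_differentiableAt] with s h1 h2 hs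
    rw [← Set.uIcc_of_le hab.le] at hs
    have dx := (h1 hs).hasDerivAt
    have dy := (h2 hs).hasDerivAt
    have dv : HasDerivAt v (p * deriv y s - q * deriv x s) s :=
      (dy.const_mul p).sub (dx.const_mul q)
    have du : HasDerivAt u (p * deriv x s + q * deriv y s) s :=
      (dx.const_mul p).add (dy.const_mul q)
    have dG := (((hτd s hs).mul (dv.mul dv)).add ((du.mul dv).const_mul (-ω))).deriv
    have e : deriv G s = _ := dG
    rw [e]
    simp only [Pi.zero_apply, Pi.mul_apply]
    generalize τ s = c
    generalize deriv x s = X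
    generalize deriv y s = Y
    have e1 : X ^ 2 + Y ^ 2 = (p * X + q * Y) ^ 2 + (p * Y - q * X) ^ 2 := by
      linear_combination (-(X ^ 2 + Y ^ 2)) * hpq
    have e2 : X * y s - x s * Y = (p * X + q * Y) * v s - u s * (p * Y - q * X) := by
      simp only [hu, hv]
      linear_combination (-(X * y s - x s * Y)) * hpq
    rw [e1, e2]
    generalize p * X + q * Y = U
    generalize p * Y - q * X = V
    nlinarith [sq_nonneg (U - ω * v s), sq_nonneg (V + c * v s)]
  rw [intervalIntegral.integral_add (hI1.sub (hI2.const_mul ω)) hI3,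
    intervalIntegral.integral_sub hI1 (hI2.const_mul ω), hGint,
    intervalIntegral.integral_const_mul] at key
  linarith

lemma exists_line (X Y : ℝ) : ∃ p q : ℝ, p ^ 2 + q ^ 2 = 1 ∧ p * Y - q * X = 0 := by
  by_cases h : X ^ 2 + Y ^ 2 = 0
  · have hX : X = 0 := by nlinarith [sq_nonneg X, sq_nonneg Y]
    have hY : Y = 0 := by nlinarith [sq_nonneg X, sq_nonneg Y]
    exact ⟨1, 0, by norm_num, by simp [hX, hY]⟩
  · have hp : 0 < X ^ 2 + Y ^ 2 := lt_of_le_of_ne (by positivity) (Ne.symm h)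
    have hs := Real.sq_sqrt hp.le
    have hs0 : √(X ^ 2 + Y ^ 2) ≠ 0 := (Real.sqrt_pos.2 hp).ne'
    refine ⟨X / √(X ^ 2 + Y ^ 2), Y / √(X ^ 2 + Y ^ 2), ?_, by ring⟩
    rw [div_pow, div_pow, hs, ← add_div, div_self h]

lemma lip_sq_integrable {x : ℝ → ℝ} {K : NNReal} (hx : LipschitzOnWith K x (Set.Icc 0 1)) :
    IntervalIntegrable (fun s => deriv x s ^ 2) volume 0 1 := by
  rw [intervalIntegrable_iff_integrableOn_Ioo_of_le zero_le_one]
  refine Measure.integrableOn_of_bounded (M := (K : ℝ) ^ 2) (by simp)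
    ((measurable_deriv x).pow_const 2).aestronglyMeasurable ?_
  rw [ae_restrict_iff' measurableSet_Ioo]
  refine Filter.Eventually.of_forall fun s hs => ?_
  have := norm_deriv_le_of_lipschitzOn (Icc_mem_nhds hs.1 hs.2) hx
  rw [norm_pow]
  gcongr

lemma full_ineq {x y : ℝ → ℝ} {K : NNReal} {ω : ℝ}
    (hx : LipschitzOnWith K x (Set.Icc 0 1)) (hy : LipschitzOnWith K y (Set.Icc 0 1))
    (h0 : x 0 = 0 ∧ y 0 = 0) (h1 : x 1 = 0 ∧ y 1 = 0) (hω : 0 < ω) (hω' : ω < 2 * π) :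
    ω * ∫ s in (0:ℝ)..1, (deriv x s * y s - x s * deriv y s) ≤
      ∫ s in (0:ℝ)..1, (deriv x s ^ 2 + deriv y s ^ 2) := by
  obtain ⟨p, q, hpq, hl⟩ := exists_line (x (1/2)) (y (1/2))
  have hx' : AbsolutelyContinuousOnInterval x 0 1 := by
    apply LipschitzOnWith.absolutelyContinuousOnInterval (K := K)
    rwa [Set.uIcc_of_le zero_le_one]
  have hy' : AbsolutelyContinuousOnInterval y 0 1 := by
    apply LipschitzOnWith.absolutelyContinuousOnInterval (K := K)
    rwa [Set.uIcc_of_le zero_le_one]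
  have hx2 := lip_sq_integrable hx
  have hy2 := lip_sq_integrable hy
  have s1 : Set.uIcc (0:ℝ) (1/2) ⊆ Set.uIcc 0 1 := by
    rw [Set.uIcc_of_le (by norm_num), Set.uIcc_of_le (by norm_num)]
    exact Set.Icc_subset_Icc (by norm_num) (by norm_num)
  have s2 : Set.uIcc (1/2:ℝ) 1 ⊆ Set.uIcc 0 1 := by
    rw [Set.uIcc_of_le (by norm_num), Set.uIcc_of_le (by norm_num)]
    exact Set.Icc_subset_Icc (by norm_num) (by norm_num)
  have i1 := half_ineq (by norm_num) (hx'.mono s1) (hy'.mono s1) (hx2.mono_set s1)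
    (hy2.mono_set s1) hpq (by simp [h0]) hl hω (by linarith)
  have i2 := half_ineq (by norm_num) (hx'.mono s2) (hy'.mono s2) (hx2.mono_set s2)
    (hy2.mono_set s2) hpq hl (by simp [h1]) hω (by linarith)
  have hI1 : IntervalIntegrable (fun s => deriv x s ^ 2 + deriv y s ^ 2) volume 0 1 := hx2.add hy2
  have hI2 : IntervalIntegrable (fun s => deriv x s * y s - x s * deriv y s) volume 0 1 :=
    (hx'.intervalIntegrable_deriv.mul_continuousOn hy'.continuousOn).sub
      (hy'.intervalIntegrable_deriv.continuousOn_mul hx'.continuousOn)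
  rw [← intervalIntegral.integral_add_adjacent_intervals (hI1.mono_set s1) (hI1.mono_set s2),
    ← intervalIntegral.integral_add_adjacent_intervals (hI2.mono_set s1) (hI2.mono_set s2)]
  linarith

/-- For any horizontal constant-speed curve in `ℍⁿ` from the origin to
`(0,0,T)` with `T > 0`, the horizontal length `L` satisfies `L² ≥ πT`. -/
theorem length_sq_ge_pi_T
    (n : ℕ) (x y : Fin n → ℝ → ℝ) (t : ℝ → ℝ) (T L : ℝ)
    (hT : 0 < T) (hL : 0 ≤ L) (K : NNReal)
    (hx : ∀ j, LipschitzOnWith K (x j) (Set.Icc 0 1))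
    (hy : ∀ j, LipschitzOnWith K (y j) (Set.Icc 0 1))
    (h0 : ∀ j, x j 0 = 0 ∧ y j 0 = 0)
    (h1 : ∀ j, x j 1 = 0 ∧ y j 1 = 0)
    (ht0 : t 0 = 0) (ht1 : t 1 = T)
    (hhor : ∀ s ∈ Set.Icc (0:ℝ) 1, t s - t 0 =
      2 * ∑ j, ∫ τ in (0:ℝ)..s, (deriv (x j) τ * y j τ - x j τ * deriv (y j) τ))
    (hspeed : ∀ᵐ s ∂(volume.restrict (Set.Icc (0:ℝ) 1)),
      ∑ j, ((deriv (x j) s) ^ 2 + (deriv (y j) s) ^ 2) = L ^ 2) :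
    L ^ 2 ≥ π * T := by
  have hT' := hhor 1 (by simp)
  rw [ht0, ht1, sub_zero] at hT'
  have hLs : ∑ j, ∫ s in (0:ℝ)..1, (deriv (x j) s ^ 2 + deriv (y j) s ^ 2) = L ^ 2 := by
    rw [← intervalIntegral.integral_finsetSum fun j _ =>
      (lip_sq_integrable (hx j)).add (lip_sq_integrable (hy j))]
    have : ∫ s in (0:ℝ)..1, ∑ j, (deriv (x j) s ^ 2 + deriv (y j) s ^ 2)
        = ∫ s in (0:ℝ)..1, L ^ 2 := by
      apply intervalIntegral.integral_congr_ae
      rw [ae_restrict_iff' measurableSet_Icc] at hspeed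
      filter_upwards [hspeed] with s hs hs'
      rw [Set.uIoc_of_le zero_le_one] at hs'
      exact hs (Set.Ioc_subset_Icc_self hs')
    rw [this]
    simp
  have main : ∀ ω : ℝ, 0 < ω → ω < 2 * π → ω * (T / 2) ≤ L ^ 2 := by
    intro ω h h'
    rw [← hLs, hT', mul_div_cancel_left₀ _ two_ne_zero, Finset.mul_sum]
    exact Finset.sum_le_sum fun j _ => full_ineq (hx j) (hy j) (h0 j) (h1 j) h h'
  by_contra! hcon
  have hlt : L ^ 2 / (T / 2) < 2 * π := by
    rw [div_lt_iff₀ (by positivity)]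
    linarith
  obtain ⟨ω, hω1, hω2⟩ := exists_between hlt
  have hω0 : 0 < ω := lt_of_le_of_lt (by positivity) hω1
  rw [div_lt_iff₀ (by positivity)] at hω1
  linarith [main ω hω0 hω2]
end

section
/- Let Γ = (γ, t) : [0,1] → ℍⁿ be a horizontal constant-speed curve with Γ(0) = (0,0,0), Γ(1) = (0,0,T), T > 0, whose horizontal length L satisfies L² = πT. Then there exist A, B ∈ ℝⁿ with 4πΣⱼ(Aⱼ²+Bⱼ²) = T such that xⱼ(s) = Aⱼ(1 − cos 2πs) − Bⱼ sin 2πs, yⱼ(s) = Bⱼ(1 − cos 2πs) + Aⱼ sin 2πs, and t(s) = T(s − sin(2πs)/(2π)). -/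
open Real MeasureTheory

theorem acSum {ι : Type*} (S : Finset ι) (f : ι → ℝ → ℝ) (a b : ℝ)
    (h : ∀ j, AbsolutelyContinuousOnInterval (f j) a b) :
    AbsolutelyContinuousOnInterval (fun s => ∑ j ∈ S, f j s) a b := by
  classical
  induction S using Finset.induction_on with
  | empty =>
    simp only [Finset.sum_empty]
    exact ((LipschitzWith.const (0:ℝ)).lipschitzOnWith (s := Set.uIcc a b)).absolutelyContinuousOnInterval
  | insert i S hi ih =>
    simp only [Finset.sum_insert hi]
    exact (h i).fun_add ih

theorem acMono (f f' : ℝ → ℝ) (a b : ℝ) (hab : a ≤ b)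
    (h : AbsolutelyContinuousOnInterval f a b)
    (hd : ∀ᵐ s, s ∈ Set.Icc a b → HasDerivAt f (f' s) s) (hn : ∀ s, 0 ≤ f' s) : f a ≤ f b := by
  have h1 := h.integral_deriv_eq_sub
  have h2 : 0 ≤ ∫ s in a..b, deriv f s := by
    apply intervalIntegral.integral_nonneg_of_ae_restrict hab
    rw [Filter.EventuallyLE, ae_restrict_iff' measurableSet_Icc]
    filter_upwards [hd] with s hs hm
    rw [(hs hm).deriv]
    exact hn s
  linarith

theorem sinPos {s : ℝ} (hs : s ∈ Set.Ioo (0:ℝ) 1) : 0 < Real.sin (π * s) := by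
  apply Real.sin_pos_of_pos_of_lt_pi
  · exact mul_pos Real.pi_pos hs.1
  · nlinarith [Real.pi_pos, hs.2]

theorem cotDeriv {s : ℝ} (hs : s ∈ Set.Ioo (0:ℝ) 1) :
    HasDerivAt (fun s => Real.cos (π * s) / Real.sin (π * s))
      (-π - π * (Real.cos (π * s) / Real.sin (π * s)) ^ 2) s := by
  have h := sinPos hs
  have hl : HasDerivAt (fun s : ℝ => π * s) π s := by
    simpa using (hasDerivAt_id s).const_mul π
  convert! (hl.cos).div (hl.sin) h.ne' using 1
  field_simp

theorem cotAC {a b : ℝ} (ha : a ∈ Set.Ioo (0:ℝ) 1) (hb : b ∈ Set.Ioo (0:ℝ) 1) :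
    AbsolutelyContinuousOnInterval (fun s => Real.cos (π * s) / Real.sin (π * s)) a b := by
  apply ContDiffOn.absolutelyContinuousOnInterval
  apply ContDiffOn.div
  · fun_prop
  · fun_prop
  · intro s hs
    exact (sinPos (Set.ordConnected_Ioo.uIcc_subset ha hb hs)).ne'

theorem sinLower {s : ℝ} (h0 : 0 ≤ s) (h1 : s ≤ 1 / 2) : 2 * s ≤ Real.sin (π * s) := by
  have := Real.mul_le_sin (x := π * s) (by positivity) (by nlinarith [Real.pi_pos])
  have e : 2 / π * (π * s) = 2 * s := by field_simp
  linarith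

theorem cotBound {s C R u : ℝ} (hu0 : 0 < u) (hu : 2 * u ≤ Real.sin (π * s)) (hC : 0 ≤ C)
    (hR0 : 0 ≤ R) (hR : R ≤ C * u ^ 2) :
    |π * (Real.cos (π * s) / Real.sin (π * s)) * R| ≤ π * C * u := by
  have hs : 0 < Real.sin (π * s) := by linarith
  rw [abs_mul, abs_mul, abs_div, abs_of_pos Real.pi_pos, abs_of_pos hs, abs_of_nonneg hR0]
  have h1 : |Real.cos (π * s)| / Real.sin (π * s) ≤ 1 / u := by
    apply div_le_div₀ zero_le_one (Real.abs_cos_le_one _) hu0 (by linarith)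
  have h2 : |Real.cos (π * s)| / Real.sin (π * s) * R ≤ 1 / u * (C * u ^ 2) := by
    apply mul_le_mul h1 hR hR0 (by positivity)
  have h3 : 1 / u * (C * u ^ 2) = C * u := by field_simp
  rw [mul_assoc, mul_assoc]
  apply mul_le_mul_of_nonneg_left _ Real.pi_pos.le
  linarith

theorem constIoo (f : ℝ → ℝ) (h : ∀ a ∈ Set.Ioo (0:ℝ) 1, ∀ b ∈ Set.Ioo (0:ℝ) 1,
      AbsolutelyContinuousOnInterval f a b)
    (hd : ∀ᵐ s, s ∈ Set.Ioo (0:ℝ) 1 → HasDerivAt f 0 s) :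
    ∀ s ∈ Set.Ioo (0:ℝ) 1, f s = f (1/2) := by
  intro s hs
  have hh : (1/2 : ℝ) ∈ Set.Ioo (0:ℝ) 1 := by constructor <;> norm_num
  obtain ⟨C, hC⟩ := (h s hs _ hh).const_of_ae_hasDerivAt_zero (by
    filter_upwards [hd] with r hr hm
    exact hr (Set.ordConnected_Ioo.uIcc_subset hs hh hm))
  rw [hC s Set.left_mem_uIcc, hC _ Set.right_mem_uIcc]

theorem explicitPair (x y : ℝ → ℝ)
    (hx : AbsolutelyContinuousOnInterval x 0 1) (hy : AbsolutelyContinuousOnInterval y 0 1)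
    (hd : ∀ᵐ s, s ∈ Set.Ioo (0:ℝ) 1 → HasDerivAt x
      (π * y s + π * (Real.cos (π * s) / Real.sin (π * s)) * x s) s ∧
      HasDerivAt y (-π * x s + π * (Real.cos (π * s) / Real.sin (π * s)) * y s) s) :
    ∃ A B : ℝ, ∀ s ∈ Set.Ioo (0:ℝ) 1,
      x s = A * (1 - Real.cos (2 * π * s)) - B * Real.sin (2 * π * s) ∧
      y s = B * (1 - Real.cos (2 * π * s)) + A * Real.sin (2 * π * s) := by
  have hsub : ∀ a ∈ Set.Ioo (0:ℝ) 1, ∀ b ∈ Set.Ioo (0:ℝ) 1,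
      Set.uIcc a b ⊆ Set.uIcc 0 1 := by
    intro a ha b hb
    rw [Set.uIcc_of_le (zero_le_one : (0:ℝ) ≤ 1)]
    exact (Set.ordConnected_Ioo.uIcc_subset ha hb).trans Set.Ioo_subset_Icc_self
  have c1 := constIoo (fun s => Real.cos (π * s) / Real.sin (π * s) * x s - y s)
    (fun a ha b hb => ((cotAC ha hb).fun_mul (hx.mono (hsub a ha b hb))).fun_sub
      (hy.mono (hsub a ha b hb))) (by
    filter_upwards [hd] with s h hs
    have hp := (sinPos hs).ne'
    convert! ((cotDeriv hs).mul (h hs).1).sub (h hs).2 using 1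
    field_simp
    ring)
  have c2 := constIoo (fun s => Real.cos (π * s) / Real.sin (π * s) * y s + x s)
    (fun a ha b hb => ((cotAC ha hb).fun_mul (hy.mono (hsub a ha b hb))).fun_add
      (hx.mono (hsub a ha b hb))) (by
    filter_upwards [hd] with s h hs
    have hp := (sinPos hs).ne'
    convert! ((cotDeriv hs).mul (h hs).2).add (h hs).1 using 1
    field_simp
    ring)
  generalize hα : (fun s => Real.cos (π * s) / Real.sin (π * s) * x s - y s) (1/2) = α 
  generalize hβ : (fun s => Real.cos (π * s) / Real.sin (π * s) * y s + x s) (1/2) = β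
  refine ⟨β / 2, -α / 2, fun s hs => ?_⟩
  have e1 := (c1 s hs).trans hα
  have e2 := (c2 s hs).trans hβ
  have hp := sinPos hs
  have e3 : 2 * π * s = 2 * (π * s) := by ring
  have e4 := Real.sin_sq_add_cos_sq (π * s)
  rw [e3, Real.cos_two_mul, Real.sin_two_mul]
  set S := Real.sin (π * s)
  set c := Real.cos (π * s)
  have f1 : c * x s - y s * S = α * S := by
    rw [← e1]; field_simp
  have f2 : c * y s + x s * S = β * S := by
    rw [← e2]; field_simp
  constructor
  · linear_combination (-x s + β) * e4 + c * f1 + S * f2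
  · linear_combination (-y s - α) * e4 + c * f2 - S * f1

theorem rBound (n : ℕ) (x y : Fin n → ℝ → ℝ) (K : NNReal)
    (hx : ∀ j, LipschitzOnWith K (x j) (Set.Icc 0 1))
    (hy : ∀ j, LipschitzOnWith K (y j) (Set.Icc 0 1)) (e : ℝ) (he : e ∈ Set.Icc (0:ℝ) 1)
    (h0 : ∀ j, x j e = 0 ∧ y j e = 0) (s : ℝ) (hs : s ∈ Set.Icc (0:ℝ) 1) :
    ∑ j, ((x j s) ^ 2 + (y j s) ^ 2) ≤ (n * (2 * (K:ℝ) ^ 2)) * |s - e| ^ 2 := by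
  have : ∀ j ∈ Finset.univ, (x j s) ^ 2 + (y j s) ^ 2 ≤ 2 * (K:ℝ) ^ 2 * |s - e| ^ 2 := by
    intro j _
    have a := (hx j).dist_le_mul s hs e he
    have b := (hy j).dist_le_mul s hs e he
    rw [(h0 j).1, Real.dist_eq, Real.dist_eq, sub_zero] at a
    rw [(h0 j).2, Real.dist_eq, Real.dist_eq, sub_zero] at b
    have a2 := pow_le_pow_left₀ (abs_nonneg _) a 2
    have b2 := pow_le_pow_left₀ (abs_nonneg _) b 2
    rw [sq_abs, mul_pow] at a2 b2
    linarith
  refine (Finset.sum_le_sum this).trans (le_of_eq ?_)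
  simp
  ring

/-- Structure of geodesics: a horizontal constant-speed curve from the origin
to `(0,0,T)` with `T > 0` whose horizontal length satisfies `L² = πT` must
have the explicit circular form. -/
theorem geodesic_structure
    (n : ℕ) (x y : Fin n → ℝ → ℝ) (t : ℝ → ℝ) (T L : ℝ)
    (hT : 0 < T) (hL : 0 ≤ L) (K : NNReal)
    (hx : ∀ j, LipschitzOnWith K (x j) (Set.Icc 0 1))
    (hy : ∀ j, LipschitzOnWith K (y j) (Set.Icc 0 1))
    (h0 : ∀ j, x j 0 = 0 ∧ y j 0 = 0)
    (h1 : ∀ j, x j 1 = 0 ∧ y j 1 = 0)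
    (ht0 : t 0 = 0) (ht1 : t 1 = T)
    (hhor : ∀ s ∈ Set.Icc (0:ℝ) 1, t s - t 0 =
      2 * ∑ j, ∫ τ in (0:ℝ)..s, (deriv (x j) τ * y j τ - x j τ * deriv (y j) τ))
    (hspeed : ∀ᵐ s ∂(volume.restrict (Set.Icc (0:ℝ) 1)),
      ∑ j, ((deriv (x j) s) ^ 2 + (deriv (y j) s) ^ 2) = L ^ 2)
    (heq : L ^ 2 = π * T) :
    ∃ A B : Fin n → ℝ, 4 * π * ∑ j, ((A j) ^ 2 + (B j) ^ 2) = T ∧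
      ∀ s ∈ Set.Icc (0:ℝ) 1,
        (∀ j, x j s = A j * (1 - Real.cos (2 * π * s)) - B j * Real.sin (2 * π * s) ∧
              y j s = B j * (1 - Real.cos (2 * π * s)) + A j * Real.sin (2 * π * s)) ∧
        t s = T * (s - Real.sin (2 * π * s) / (2 * π)) := by
  classical
  have ax : ∀ j, AbsolutelyContinuousOnInterval (x j) 0 1 := fun j =>
    LipschitzOnWith.absolutelyContinuousOnInterval (K := K) (by
      rw [Set.uIcc_of_le zero_le_one]; exact hx j)
  have ay : ∀ j, AbsolutelyContinuousOnInterval (y j) 0 1 := fun j =>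
    LipschitzOnWith.absolutelyContinuousOnInterval (K := K) (by
      rw [Set.uIcc_of_le zero_le_one]; exact hy j)
  have hu : Set.uIcc (0:ℝ) 1 = Set.Icc 0 1 := Set.uIcc_of_le zero_le_one
  have gi : ∀ j, IntervalIntegrable (fun τ => deriv (x j) τ * y j τ - x j τ * deriv (y j) τ)
      volume 0 1 := fun j =>
    ((ax j).intervalIntegrable_deriv.mul_continuousOn (ay j).continuousOn).sub
      ((ay j).intervalIntegrable_deriv.continuousOn_mul (ax j).continuousOn)
  have hsub : ∀ a ∈ Set.Ioo (0:ℝ) 1, ∀ b ∈ Set.Ioo (0:ℝ) 1,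
      Set.uIcc a b ⊆ Set.uIcc 0 1 := by
    intro a ha b hb
    rw [hu]
    exact (Set.ordConnected_Ioo.uIcc_subset ha hb).trans Set.Ioo_subset_Icc_self
  set W : ℝ → ℝ := fun s => ∑ j, ∫ τ in (0:ℝ)..s,
    (deriv (x j) τ * y j τ - x j τ * deriv (y j) τ) with hW
  have Wac : AbsolutelyContinuousOnInterval W 0 1 := acSum _ _ _ _ fun j =>
    (gi j).absolutelyContinuousOnInterval_intervalIntegral (by simp)
  have tW : ∀ s ∈ Set.Icc (0:ℝ) 1, t s = 2 * W s := by
    intro s hs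
    have := hhor s hs
    rw [ht0, sub_zero] at this
    exact this
  have W0 : W 0 = 0 := by simp [hW]
  have W1 : 2 * W 1 = T := by rw [← ht1, tW 1 (by simp)]
  set R : ℝ → ℝ := fun s => ∑ j, ((x j s) ^ 2 + (y j s) ^ 2) with hR
  have R0 : ∀ s, 0 ≤ R s := fun s => Finset.sum_nonneg fun j _ => by positivity
  have Rac : AbsolutelyContinuousOnInterval R 0 1 := acSum _ _ _ _ fun j => by
    simp only [pow_two]
    exact ((ax j).fun_mul (ax j)).fun_add ((ay j).fun_mul (ay j))
  set c : ℝ → ℝ := fun s => Real.cos (π * s) / Real.sin (π * s) with hc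
  set Φ : ℝ → ℝ := fun s => L ^ 2 * s - 2 * π * W s - π * c s * R s with hΦ
  set D : ℝ → ℝ := fun s => ∑ j, ((deriv (x j) s - π * y j s - π * c s * x j s) ^ 2 +
    (deriv (y j) s + π * x j s - π * c s * y j s) ^ 2) with hD
  have D0 : ∀ s, 0 ≤ D s := fun s => Finset.sum_nonneg fun j _ => by positivity
  -- almost everywhere differentiability
  have dx : ∀ᵐ s, ∀ j, s ∈ Set.uIcc (0:ℝ) 1 → DifferentiableAt ℝ (x j) s :=
    ae_all_iff.2 fun j => (ax j).ae_differentiableAt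
  have dy : ∀ᵐ s, ∀ j, s ∈ Set.uIcc (0:ℝ) 1 → DifferentiableAt ℝ (y j) s :=
    ae_all_iff.2 fun j => (ay j).ae_differentiableAt
  have dW : ∀ᵐ s, s ∈ Set.Ioo (0:ℝ) 1 →
      HasDerivAt W (∑ j, (deriv (x j) s * y j s - x j s * deriv (y j) s)) s := by
    have : ∀ᵐ s, ∀ j, _ := ae_all_iff.2 fun j => (gi j).ae_hasDerivAt_integral
    filter_upwards [this] with s h hs
    exact HasDerivAt.fun_sum fun j _ => h j (hu ▸ Set.Ioo_subset_Icc_self hs) 0 (by simp)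
  rw [ae_restrict_iff' measurableSet_Icc] at hspeed
  have dΦ : ∀ᵐ s, s ∈ Set.Ioo (0:ℝ) 1 → HasDerivAt Φ (D s) s := by
    filter_upwards [dx, dy, dW, hspeed] with s hdx hdy hdW hsp hs
    have hs' : s ∈ Set.uIcc (0:ℝ) 1 := hu ▸ Set.Ioo_subset_Icc_self hs
    have hsp := hsp (Set.Ioo_subset_Icc_self hs)
    have dR : HasDerivAt R (∑ j, (2 * x j s * deriv (x j) s + 2 * y j s * deriv (y j) s)) s := by
      apply HasDerivAt.fun_sum
      intro j _
      convert! ((hdx j hs').hasDerivAt.pow 2).add ((hdy j hs').hasDerivAt.pow 2) using 1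
      norm_num
    have l : HasDerivAt (fun s : ℝ => L ^ 2 * s) (L ^ 2) s := by
      simpa using (hasDerivAt_id s).const_mul (L ^ 2)
    convert! (l.sub ((hdW hs).const_mul (2 * π))).sub
      (((cotDeriv hs).const_mul π).mul dR) using 1
    rw [← hsp]
    simp only [hD, hR, Finset.mul_sum, ← Finset.sum_sub_distrib, ← Finset.sum_add_distrib]
    refine Finset.sum_congr rfl fun j _ => ?_
    simp only [hc]
    ring
  have mΦ : ∀ a ∈ Set.Ioo (0:ℝ) 1, ∀ b ∈ Set.Ioo (0:ℝ) 1, a ≤ b → Φ a ≤ Φ b := by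
    intro a ha b hb hab
    apply acMono Φ D a b hab _ _ D0
    · have l : AbsolutelyContinuousOnInterval (fun s : ℝ => L ^ 2 * s) a b :=
        ContDiffOn.absolutelyContinuousOnInterval (by fun_prop)
      exact (l.fun_sub ((Wac.mono (hsub a ha b hb)).const_mul (2 * π))).fun_sub
        (((cotAC ha hb).const_mul π).fun_mul (Rac.mono (hsub a ha b hb)))
    · filter_upwards [dΦ] with s h hs
      exact h ⟨ha.1.trans_le hs.1, hs.2.trans_lt hb.2⟩
  set C : ℝ := n * (2 * (K:ℝ) ^ 2) with hC
  have hC0 : 0 ≤ C := by positivity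
  have Wc : ContinuousOn W (Set.Icc 0 1) := hu ▸ Wac.continuousOn
  have lim0 : Filter.Tendsto Φ (nhdsWithin 0 (Set.Ioo 0 1)) (nhds 0) := by
    have h1 : Filter.Tendsto (fun s => L ^ 2 * s - 2 * π * W s) (nhdsWithin 0 (Set.Ioo 0 1))
        (nhds (L ^ 2 * 0 - 2 * π * W 0)) := by
      have w : ContinuousWithinAt W (Set.Ioo 0 1) 0 :=
        (Wc 0 (by simp)).mono Set.Ioo_subset_Icc_self
      exact (continuousWithinAt_id.const_mul (L ^ 2)).sub (w.const_mul (2 * π))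
    have h2 : Filter.Tendsto (fun s => π * c s * R s) (nhdsWithin 0 (Set.Ioo 0 1))
        (nhds 0) := by
      have h3 : Filter.Tendsto (fun s => π * C * s) (nhdsWithin (0:ℝ) (Set.Ioo 0 1))
          (nhds (π * C * 0)) := (continuousWithinAt_id.const_mul (π * C))
      rw [mul_zero] at h3
      apply squeeze_zero_norm' _ h3
      have e1 : ∀ᶠ s in nhdsWithin (0:ℝ) (Set.Ioo 0 1), s < 1/2 :=
        nhdsWithin_le_nhds (Iio_mem_nhds (by norm_num))
      filter_upwards [e1, self_mem_nhdsWithin] with s hs1 hs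
      rw [Real.norm_eq_abs]
      apply cotBound hs.1 (sinLower hs.1.le hs1.le) hC0 (R0 s)
      have := rBound n x y K hx hy 0 (by simp) h0 s (Set.Ioo_subset_Icc_self hs)
      rwa [sub_zero, sq_abs] at this
    have := h1.sub h2
    rw [W0] at this
    simpa using this
  have lim1 : Filter.Tendsto Φ (nhdsWithin 1 (Set.Ioo 0 1)) (nhds 0) := by
    have k1 : Filter.Tendsto (fun s => L ^ 2 * s - 2 * π * W s) (nhdsWithin 1 (Set.Ioo 0 1))
        (nhds (L ^ 2 * 1 - 2 * π * W 1)) := by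
      have w : ContinuousWithinAt W (Set.Ioo 0 1) 1 :=
        (Wc 1 (by simp)).mono Set.Ioo_subset_Icc_self
      exact (continuousWithinAt_id.const_mul (L ^ 2)).sub (w.const_mul (2 * π))
    have h2 : Filter.Tendsto (fun s => π * c s * R s) (nhdsWithin 1 (Set.Ioo 0 1))
        (nhds 0) := by
      have h3 : Filter.Tendsto (fun s => π * C * (1 - s)) (nhdsWithin (1:ℝ) (Set.Ioo 0 1))
          (nhds (π * C * (1 - 1))) :=
        ((continuousWithinAt_const.sub continuousWithinAt_id).const_mul (π * C))
      rw [sub_self, mul_zero] at h3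
      apply squeeze_zero_norm' _ h3
      have e1 : ∀ᶠ s in nhdsWithin (1:ℝ) (Set.Ioo 0 1), 1/2 < s :=
        nhdsWithin_le_nhds (Ioi_mem_nhds (by norm_num))
      filter_upwards [e1, self_mem_nhdsWithin] with s hs1 hs
      rw [Real.norm_eq_abs]
      have hl := sinLower (s := 1 - s) (by linarith [hs.2]) (by linarith)
      rw [show π * (1 - s) = π - π * s by ring, Real.sin_pi_sub] at hl
      apply cotBound (by linarith [hs.2]) hl hC0 (R0 s)
      have := rBound n x y K hx hy 1 (by simp) h1 s (Set.Ioo_subset_Icc_self hs)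
      rw [sq_abs] at this
      rw [show (1 - s) ^ 2 = (s - 1) ^ 2 by ring]
      exact this
    have := k1.sub h2
    rw [show L ^ 2 * 1 - 2 * π * W 1 - 0 = 0 by rw [heq, ← W1]; ring] at this
    exact this
  have Φ0 : ∀ s ∈ Set.Ioo (0:ℝ) 1, Φ s = 0 := by
    intro s hs
    have nb0 : (nhdsWithin (0:ℝ) (Set.Ioo 0 1)).NeBot := by
      rw [← mem_closure_iff_nhdsWithin_neBot, closure_Ioo (by norm_num)]; simp
    have nb1 : (nhdsWithin (1:ℝ) (Set.Ioo 0 1)).NeBot := by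
      rw [← mem_closure_iff_nhdsWithin_neBot, closure_Ioo (by norm_num)]; simp
    apply le_antisymm
    · apply ge_of_tendsto lim1
      have e1 : ∀ᶠ r in nhdsWithin (1:ℝ) (Set.Ioo 0 1), s < r :=
        nhdsWithin_le_nhds (Ioi_mem_nhds hs.2)
      filter_upwards [e1, self_mem_nhdsWithin] with r hr hr'
      exact mΦ s hs r hr' hr.le
    · apply le_of_tendsto lim0
      have e1 : ∀ᶠ r in nhdsWithin (0:ℝ) (Set.Ioo 0 1), r < s :=
        nhdsWithin_le_nhds (Iio_mem_nhds hs.1)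
      filter_upwards [e1, self_mem_nhdsWithin] with r hr hr'
      exact mΦ r hr' s hs hr.le
  have Dz : ∀ᵐ s, s ∈ Set.Ioo (0:ℝ) 1 → D s = 0 := by
    filter_upwards [dΦ] with s h hs
    have z : HasDerivAt Φ 0 s := (hasDerivAt_const s (0:ℝ)).congr_of_eventuallyEq (by
      filter_upwards [isOpen_Ioo.mem_nhds hs] with r hr using Φ0 r hr)
    exact (h hs).unique z
  have ex : ∀ j, ∃ A B : ℝ, ∀ s ∈ Set.Ioo (0:ℝ) 1,
      x j s = A * (1 - Real.cos (2 * π * s)) - B * Real.sin (2 * π * s) ∧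
      y j s = B * (1 - Real.cos (2 * π * s)) + A * Real.sin (2 * π * s) := by
    intro j
    apply explicitPair _ _ (ax j) (ay j)
    filter_upwards [dx, dy, Dz] with s hdx hdy hz hs
    have hs' : s ∈ Set.uIcc (0:ℝ) 1 := hu ▸ Set.Ioo_subset_Icc_self hs
    have := (Finset.sum_eq_zero_iff_of_nonneg (fun j _ => by positivity)).1 (hz hs) j
      (Finset.mem_univ j)
    have p : deriv (x j) s - π * y j s - π * c s * x j s = 0 := by
      rw [← sq_eq_zero_iff]; nlinarith
    have q : deriv (y j) s + π * x j s - π * c s * y j s = 0 := by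
      rw [← sq_eq_zero_iff]; nlinarith
    constructor
    · convert! (hdx j hs').hasDerivAt using 1
      linarith
    · convert! (hdy j hs').hasDerivAt using 1
      linarith
  choose A B hAB using ex
  have hl : ∀ s : ℝ, HasDerivAt (fun s : ℝ => 2 * π * s) (2 * π) s := fun s => by
    simpa using (hasDerivAt_id s).const_mul (2 * π)
  have ht : ∀ s ∈ Set.Icc (0:ℝ) 1,
      t s = (4 * π * ∑ j, ((A j) ^ 2 + (B j) ^ 2)) * (s - Real.sin (2 * π * s) / (2 * π)) := by
    intro s hs
    rw [tW s hs]
    simp only [hW, Finset.mul_sum, Finset.sum_mul]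
    refine Finset.sum_congr rfl fun j _ => ?_
    have e : ∫ τ in (0:ℝ)..s, (deriv (x j) τ * y j τ - x j τ * deriv (y j) τ) =
        ∫ τ in (0:ℝ)..s, (2 * π * (A j ^ 2 + B j ^ 2)) * (1 - Real.cos (2 * π * τ)) := by
      apply intervalIntegral.integral_congr_ae
      have n1 : ∀ᵐ r : ℝ, r ≠ 1 := by simp [ae_iff, measure_singleton]
      filter_upwards [n1] with r hr hrm
      rw [Set.uIoc_of_le hs.1] at hrm
      have hr' : r ∈ Set.Ioo (0:ℝ) 1 := ⟨hrm.1, lt_of_le_of_ne (hrm.2.trans hs.2) hr⟩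
      have d1 : HasDerivAt (x j)
          (A j * (2 * π * Real.sin (2 * π * r)) - B j * (2 * π * Real.cos (2 * π * r))) r := by
        have : HasDerivAt (fun s => A j * (1 - Real.cos (2 * π * s)) - B j * Real.sin (2 * π * s))
          (A j * (2 * π * Real.sin (2 * π * r)) - B j * (2 * π * Real.cos (2 * π * r))) r := by
          convert! (((hl r).cos.const_sub 1).const_mul (A j)).sub
            ((hl r).sin.const_mul (B j)) using 1
          ring
        apply this.congr_of_eventuallyEq
        filter_upwards [isOpen_Ioo.mem_nhds hr'] with q hq using (hAB j q hq).1
      have d2 : HasDerivAt (y j)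
          (B j * (2 * π * Real.sin (2 * π * r)) + A j * (2 * π * Real.cos (2 * π * r))) r := by
        have : HasDerivAt (fun s => B j * (1 - Real.cos (2 * π * s)) + A j * Real.sin (2 * π * s))
          (B j * (2 * π * Real.sin (2 * π * r)) + A j * (2 * π * Real.cos (2 * π * r))) r := by
          convert! (((hl r).cos.const_sub 1).const_mul (B j)).add
            ((hl r).sin.const_mul (A j)) using 1
          ring
        apply this.congr_of_eventuallyEq
        filter_upwards [isOpen_Ioo.mem_nhds hr'] with q hq using (hAB j q hq).2
      rw [d1.deriv, d2.deriv, (hAB j r hr').1, (hAB j r hr').2]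
      linear_combination (2 * π * (A j ^ 2 + B j ^ 2)) * Real.sin_sq_add_cos_sq (2 * π * r)
    rw [e, intervalIntegral.integral_eq_sub_of_hasDerivAt
      (f := fun s => (2 * π * (A j ^ 2 + B j ^ 2)) * (s - Real.sin (2 * π * s) / (2 * π)))]
    · simp only [mul_zero, Real.sin_zero]
      ring
    · intro r _
      have : HasDerivAt (fun s : ℝ => s - Real.sin (2 * π * s) / (2 * π))
          (1 - Real.cos (2 * π * r)) r := by
        convert! (hasDerivAt_id r).sub ((hl r).sin.div_const (2 * π)) using 1
        field_simp
      exact this.const_mul _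
    · apply Continuous.intervalIntegrable
      fun_prop
  have hT4 : 4 * π * ∑ j, ((A j) ^ 2 + (B j) ^ 2) = T := by
    have := ht 1 (by simp)
    rw [ht1] at this
    simpa using this.symm
  refine ⟨A, B, hT4, fun s hs => ⟨fun j => ?_, ?_⟩⟩
  · rcases eq_or_lt_of_le hs.1 with h | h
    · subst h
      simp [h0 j]
    · rcases eq_or_lt_of_le hs.2 with h' | h'
      · subst h'
        simp [h1 j]
      · exact hAB j s ⟨h, h'⟩
  · rw [ht s hs, hT4]
end
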